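/- For every prime p, the set of real numbers α such that liminf_{q→∞} q·(log q)²·‖qα‖·|q|_p > 0 has full Hausdorff dimension. -/

import Mathlib

open Filter

noncomputable def nint (y : ℝ) : ℝ := |y - round y|

noncomputable def pabs (p x : ℕ) : ℝ := (p : ℝ) ^ (-(padicValNat p x : ℤ))

open MeasureTheory

/-- Bonferroni type inequality. -/
lemma bonf {ι : Type*} [DecidableEq ι] (s : Finset ι) (A : ι → Set ℝ) (hA : ∀ i, MeasurableSet (A i)) :
    ∑ i ∈ s, volume (A i) ≤ volume (⋃ i ∈ s, A i) + ∑ q ∈ s.offDiag, volume (A q.1 ∩ A q.2) := by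
  induction s using Finset.induction_on with
  | empty => simp
  | insert a s ha ih =>
    rw [Finset.sum_insert ha, Finset.set_biUnion_insert]
    have hU : MeasurableSet (⋃ i ∈ s, A i) := Finset.measurableSet_biUnion _ (fun i _ => hA i)
    have h1 := measure_union_add_inter (μ := volume) (A a) hU
    have h2 : volume (A a ∩ ⋃ i ∈ s, A i) ≤ ∑ i ∈ s, volume (A a ∩ A i) := by
      rw [Set.inter_iUnion₂]
      exact measure_biUnion_finset_le _ _
    have h3 : ∑ q ∈ s.offDiag, volume (A q.1 ∩ A q.2) + ∑ i ∈ s, volume (A a ∩ A i)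
        ≤ ∑ q ∈ (insert a s).offDiag, volume (A q.1 ∩ A q.2) := by
      have : ∑ i ∈ s, volume (A a ∩ A i) = ∑ q ∈ s.image (fun i => (a, i)), volume (A q.1 ∩ A q.2) := by
        rw [Finset.sum_image]
        intro x _ y _ h
        simpa using h
      rw [this, ← Finset.sum_union]
      · apply Finset.sum_le_sum_of_subset
        intro q hq
        simp only [Finset.mem_union, Finset.mem_image, Finset.mem_offDiag, Finset.mem_insert] at *
        rcases hq with hq | ⟨i, hi, rfl⟩
        · tauto
        · refine ⟨Or.inl rfl, Or.inr hi, ?_⟩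
          rintro h
          simp only at h
          exact ha (h ▸ hi)
      · rw [Finset.disjoint_left]
        intro q hq hq'
        simp only [Finset.mem_image, Finset.mem_offDiag] at *
        obtain ⟨i, hi, rfl⟩ := hq'
        exact ha hq.1
    calc volume (A a) + ∑ i ∈ s, volume (A i)
        ≤ volume (A a) + (volume (⋃ i ∈ s, A i) + ∑ q ∈ s.offDiag, volume (A q.1 ∩ A q.2)) := by gcongr
      _ = (volume (A a ∪ ⋃ i ∈ s, A i) + volume (A a ∩ ⋃ i ∈ s, A i)) + ∑ q ∈ s.offDiag, volume (A q.1 ∩ A q.2) := by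
          rw [h1, add_assoc]
      _ ≤ (volume (A a ∪ ⋃ i ∈ s, A i) + ∑ i ∈ s, volume (A a ∩ A i)) + ∑ q ∈ s.offDiag, volume (A q.1 ∩ A q.2) := by gcongr
      _ = volume (A a ∪ ⋃ i ∈ s, A i) + (∑ q ∈ s.offDiag, volume (A q.1 ∩ A q.2) + ∑ i ∈ s, volume (A a ∩ A i)) := by
          ring
      _ ≤ _ := by gcongr

/-- Counting close pairs of fractions in a full period. -/
lemma count_pairs (Q1 Q2 b : ℕ) (h1 : 0 < Q1) (h2 : 0 < Q2) (δ : ℝ) (hδ : 0 ≤ δ) :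
    (((Finset.Ico (b * Q1) ((b + 1) * Q1) ×ˢ Finset.Ico (b * Q2) ((b + 1) * Q2)).filter
      (fun a : ℕ × ℕ => a.1 * Q2 ≠ a.2 * Q1 ∧ |(a.1 : ℝ) / Q1 - (a.2 : ℝ) / Q2| ≤ δ)).card : ℝ)
      ≤ 2 * δ * Q1 * Q2 := by
  classical
  obtain ⟨g, v, u, hg, hco, e1, e2⟩ := Nat.exists_coprime' (m := Q1) (n := Q2) (Nat.gcd_pos_of_pos_left _ h1)
  have hv : 0 < v := Nat.pos_of_mul_pos_right (e1 ▸ h1)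
  have hu : 0 < u := Nat.pos_of_mul_pos_right (e2 ▸ h2)
  set τ : ℕ := ⌊δ * g * u * v⌋₊ with hτ
  have hcard : ((Finset.Ico (b * Q1) ((b + 1) * Q1) ×ˢ Finset.Ico (b * Q2) ((b + 1) * Q2)).filter
      (fun a : ℕ × ℕ => a.1 * Q2 ≠ a.2 * Q1 ∧ |(a.1 : ℝ) / Q1 - (a.2 : ℝ) / Q2| ≤ δ)).card
      ≤ (((Finset.Icc (-(τ : ℤ)) τ).erase 0) ×ˢ (Finset.range g)).card := by
    apply Finset.card_le_card_of_injOn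
      (fun a : ℕ × ℕ => ((a.1 : ℤ) * u - a.2 * v, (a.1 - b * Q1) / v))
    · rintro ⟨a, a'⟩ ha
      simp only [Finset.coe_filter, Finset.mem_product, Finset.mem_Ico, Set.mem_ofPred_eq] at ha
      obtain ⟨⟨⟨ha1, ha2⟩, ha3, ha4⟩, hne, hle⟩ := ha
      simp only [Finset.coe_product, Set.mem_prod, Finset.mem_coe, Finset.mem_erase, Finset.mem_Icc, Finset.mem_range]
      refine ⟨⟨?_, ?_⟩, ?_⟩
      · intro h0
        apply hne
        rw [e1, e2]
        have : a * u = a' * v := by zify; linarith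
        rw [← mul_assoc, this, ← mul_assoc]
      · rw [← abs_le]
        have hr : |(((a : ℤ) * u - a' * v : ℤ) : ℝ)| ≤ δ * g * u * v := by
          have : (((a : ℤ) * u - a' * v : ℤ) : ℝ) = ((a : ℝ) / Q1 - (a' : ℝ) / Q2) * (g * u * v) := by
            rw [e1, e2]
            push_cast
            field_simp
          rw [this, abs_mul, abs_of_nonneg (by positivity : (0 : ℝ) ≤ g * u * v)]
          calc _ ≤ δ * (g * u * v) := by gcongr
            _ = _ := by ring
        rw [← Int.cast_abs] at hr
        have h3 : (((|(a : ℤ) * u - a' * v|).toNat : ℕ) : ℝ) ≤ δ * g * u * v := by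
          have : (((|(a : ℤ) * u - a' * v|).toNat : ℕ) : ℤ) = |(a : ℤ) * u - a' * v| := Int.toNat_of_nonneg (abs_nonneg _)
          rw [← this] at hr
          exact_mod_cast hr
        have h4 := Nat.le_floor h3
        rw [← hτ] at h4
        omega
      · rw [Nat.div_lt_iff_lt_mul hv]
        rw [mul_comm g v, ← e1]
        rw [add_mul, one_mul] at ha2
        omega
    · rintro ⟨a, a'⟩ ha ⟨c, c'⟩ hc heq
      simp only [Finset.coe_filter, Finset.mem_product, Finset.mem_Ico, Set.mem_ofPred_eq] at ha hc
      simp only [Prod.mk.injEq] at heq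
      obtain ⟨hw, hd⟩ := heq
      have hdv : (v : ℤ) ∣ (a : ℤ) - c := by
        have : (v : ℤ) ∣ ((a : ℤ) - c) * u := ⟨a' - c', by linarith⟩
        exact (Int.isCoprime_iff_gcd_eq_one.2 (by simpa using hco)).dvd_of_dvd_mul_right this
      have hm : a - b * Q1 ≡ c - b * Q1 [MOD v] := by
        rw [Nat.modEq_iff_dvd]
        rw [Nat.cast_sub ha.1.1.1, Nat.cast_sub hc.1.1.1]
        have h6 := (dvd_neg (a := (v : ℤ))).2 hdv
        have h7 : (c : ℤ) - ((b * Q1 : ℕ) : ℤ) - ((a : ℤ) - ((b * Q1 : ℕ) : ℤ)) = -((a : ℤ) - c) := by ring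
        rw [h7]
        exact h6
      have hac : a - b * Q1 = c - b * Q1 := by
        rw [← Nat.div_add_mod (a - b * Q1) v, ← Nat.div_add_mod (c - b * Q1) v, hd, hm]
      have hac' : a = c := by omega
      subst hac'
      have : (a' : ℤ) * v = c' * v := by linarith
      have h5 : (a' : ℤ) = c' := mul_right_cancel₀ (by exact_mod_cast hv.ne') this
      simp only [Prod.mk.injEq, true_and]
      exact_mod_cast h5
  have hc2 : (((Finset.Icc (-(τ : ℤ)) τ).erase 0) ×ˢ (Finset.range g)).card = 2 * τ * g := by
    rw [Finset.card_product, Finset.card_range, Finset.card_erase_of_mem (by simp), Int.card_Icc]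
    congr 1
    omega
  rw [hc2] at hcard
  have hτle : (τ : ℝ) ≤ δ * g * u * v := Nat.floor_le (by positivity)
  calc _ ≤ ((2 * τ * g : ℕ) : ℝ) := by exact_mod_cast hcard
    _ = 2 * τ * g := by push_cast; ring
    _ ≤ 2 * (δ * g * u * v) * g := by gcongr
    _ = _ := by rw [e1, e2]; push_cast; ring

lemma sum_inv_sq_le (n : ℕ) : ∑ e ∈ Finset.Icc 1 n, (1 : ℝ) / (e : ℝ) ^ 2 ≤ 2 := by
  have : ∀ n : ℕ, ∑ e ∈ Finset.Icc 1 (n + 1), (1 : ℝ) / (e : ℝ) ^ 2 ≤ 2 - 1 / (n + 1) := by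
    intro n
    induction n with
    | zero => norm_num
    | succ n ih =>
      rw [Finset.sum_Icc_succ_top (by omega)]
      have : (1 : ℝ) / ((n + 1 + 1 : ℕ) : ℝ) ^ 2 ≤ 1 / (n + 1) - 1 / (n + 1 + 1) := by
        push_cast
        rw [div_sub_div _ _ (by positivity) (by positivity), div_le_div_iff₀ (by positivity) (by positivity)]
        nlinarith
      push_cast at *
      linarith
  rcases n with _ | n
  · simp
  · have h := this n
    have : (0 : ℝ) ≤ 1 / (n + 1) := by positivity
    linarith

/-- denominators: positive integers up to `X` not divisible by `p` -/
def dens (p X : ℕ) : Finset ℕ := (Finset.Icc 1 X).filter (fun m => ¬ p ∣ m)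

lemma mem_dens {p X m : ℕ} : m ∈ dens p X ↔ (1 ≤ m ∧ m ≤ X) ∧ ¬ p ∣ m := by
  simp [dens]

lemma sum_inv_dens_le (p X : ℕ) : ∑ m ∈ dens p X, (1 : ℝ) / m ≤ 1 + Real.log X := by
  have h := harmonic_le_one_add_log X
  rw [harmonic_eq_sum_Icc] at h
  push_cast at h
  refine le_trans ?_ h
  simp only [one_div]
  exact Finset.sum_le_sum_of_subset_of_nonneg (Finset.filter_subset _ _) (fun _ _ _ => by positivity)

lemma sum_inv_dens_ge (p Y : ℕ) (hp : p.Prime) :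
    Real.log (Y + 1) / 2 ≤ ∑ m ∈ dens p (2 * Y), (1 : ℝ) / m := by
  have h := log_add_one_le_harmonic Y
  rw [harmonic_eq_sum_Icc] at h
  push_cast at h
  let g : ℕ → ℕ := fun n => if p ∣ 2 * n then 2 * n - 1 else 2 * n
  have hg : ∀ n ∈ Finset.Icc 1 Y, g n ∈ dens p (2 * Y) := by
    intro n hn
    rw [Finset.mem_Icc] at hn
    rw [mem_dens]
    by_cases hd : p ∣ 2 * n
    · simp only [g, hd, if_true]
      refine ⟨by omega, fun h2 => ?_⟩
      have := (Nat.dvd_sub hd h2)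
      rw [show 2 * n - (2 * n - 1) = 1 by omega] at this
      exact hp.one_lt.ne' (Nat.dvd_one.1 this)
    · simp only [g, hd, if_false]
      exact ⟨by omega, not_false⟩
  have hinj : Set.InjOn g (Finset.Icc 1 Y : Finset ℕ) := by
    intro a ha c hc hac
    simp only [Finset.coe_Icc, Set.mem_Icc] at ha hc
    simp only [g] at hac
    split_ifs at hac <;> omega
  calc Real.log (Y + 1) / 2 ≤ (∑ i ∈ Finset.Icc 1 Y, (i : ℝ)⁻¹) / 2 := by
        gcongr
    _ = ∑ i ∈ Finset.Icc 1 Y, (i : ℝ)⁻¹ / 2 := by rw [Finset.sum_div]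
    _ ≤ ∑ i ∈ Finset.Icc 1 Y, (1 : ℝ) / (g i) := by
        apply Finset.sum_le_sum
        intro i hi
        have h1 : 1 ≤ g i := (mem_dens.1 (hg i hi)).1.1
        have h2 : g i ≤ 2 * i := by simp only [g]; split_ifs <;> omega
        rw [Finset.mem_Icc] at hi
        have h1' : (1 : ℝ) ≤ g i := by exact_mod_cast h1
        have h2' : (g i : ℝ) ≤ 2 * i := by exact_mod_cast h2
        have h3 : (1 : ℝ) ≤ i := by exact_mod_cast hi.1
        rw [inv_eq_one_div, div_div, div_le_div_iff₀ (by positivity) (by positivity)]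
        linarith
    _ = ∑ m ∈ (Finset.Icc 1 Y).image g, (1 : ℝ) / m := by rw [Finset.sum_image hinj]
    _ ≤ _ := by
        apply Finset.sum_le_sum_of_subset_of_nonneg
        · intro m hm
          obtain ⟨n, hn, rfl⟩ := Finset.mem_image.1 hm
          exact hg n hn
        · intros; positivity

lemma sum_totient_dens_ge (p X : ℕ) :
    (∑ m ∈ dens p X, (1 : ℝ) / m) / 2 ≤ ∑ m ∈ dens p X, (Nat.totient m : ℝ) / (m : ℝ) ^ 2 := by
  set T := ∑ m ∈ dens p X, (Nat.totient m : ℝ) / (m : ℝ) ^ 2 with hT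
  have hT0 : 0 ≤ T := Finset.sum_nonneg (fun _ _ => by positivity)
  have h2 : ∑ e ∈ dens p X, (1 : ℝ) / (e : ℝ) ^ 2 ≤ 2 :=
    (Finset.sum_le_sum_of_subset_of_nonneg (Finset.filter_subset _ _) (fun _ _ _ => by positivity)).trans
      (sum_inv_sq_le X)
  have h1 : ∑ m ∈ dens p X, (1 : ℝ) / m ≤ T * ∑ e ∈ dens p X, (1 : ℝ) / (e : ℝ) ^ 2 := by
    calc ∑ m ∈ dens p X, (1 : ℝ) / m
        = ∑ m ∈ dens p X, ∑ d ∈ m.divisors, (Nat.totient d : ℝ) / (m : ℝ) ^ 2 := by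
          apply Finset.sum_congr rfl
          intro m hm
          have hm1 := (mem_dens.1 hm).1.1
          rw [← Finset.sum_div]
          have : ∑ d ∈ m.divisors, (Nat.totient d : ℝ) = m := by
            exact_mod_cast Nat.sum_totient m
          rw [this]
          have : (m : ℝ) ≠ 0 := by positivity
          field_simp
      _ = ∑ x ∈ (dens p X).sigma (fun m => m.divisors), (Nat.totient x.2 : ℝ) / (x.1 : ℝ) ^ 2 := by
          rw [Finset.sum_sigma]
      _ = ∑ x ∈ (dens p X).sigma (fun m => m.divisors),
            (fun y : ℕ × ℕ => (Nat.totient y.1 : ℝ) / (y.1 : ℝ) ^ 2 * ((1 : ℝ) / (y.2 : ℝ) ^ 2)) (x.2, x.1 / x.2) := by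
          apply Finset.sum_congr rfl
          rintro ⟨m, d⟩ hx
          simp only [Finset.mem_sigma, Nat.mem_divisors] at hx
          obtain ⟨hm, ⟨e, rfl⟩, h0⟩ := hx
          have hd : d ≠ 0 := by rintro rfl; simp at h0
          have he : e ≠ 0 := by rintro rfl; simp at h0
          simp only
          rw [Nat.mul_div_cancel_left _ (Nat.pos_of_ne_zero hd)]
          push_cast
          have : (d : ℝ) ≠ 0 := by exact_mod_cast hd
          have : (e : ℝ) ≠ 0 := by exact_mod_cast he
          field_simp
      _ ≤ ∑ y ∈ dens p X ×ˢ dens p X, (Nat.totient y.1 : ℝ) / (y.1 : ℝ) ^ 2 * ((1 : ℝ) / (y.2 : ℝ) ^ 2) := by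
          rw [← Finset.sum_image (s := (dens p X).sigma (fun m => m.divisors))
            (g := fun x : (_ : ℕ) × ℕ => ((x.2, x.1 / x.2) : ℕ × ℕ))
            (f := fun y : ℕ × ℕ => (Nat.totient y.1 : ℝ) / (y.1 : ℝ) ^ 2 * ((1 : ℝ) / (y.2 : ℝ) ^ 2))]
          · apply Finset.sum_le_sum_of_subset_of_nonneg
            · intro y hy
              obtain ⟨⟨m, d⟩, hx, rfl⟩ := Finset.mem_image.1 hy
              simp only [Finset.mem_sigma, Nat.mem_divisors] at hx
              obtain ⟨hm, ⟨e, rfl⟩, h0⟩ := hx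
              have hd : 0 < d := by rcases Nat.eq_zero_or_pos d with rfl | h; simp at h0; exact h
              have he : 0 < e := by rcases Nat.eq_zero_or_pos e with rfl | h; simp at h0; exact h
              rw [mem_dens] at hm
              simp only [Finset.mem_product, Nat.mul_div_cancel_left _ hd, mem_dens]
              refine ⟨⟨⟨hd, le_trans (Nat.le_mul_of_pos_right _ he) hm.1.2⟩, fun h => hm.2 (h.mul_right _)⟩,
                ⟨⟨he, le_trans (Nat.le_mul_of_pos_left _ hd) hm.1.2⟩, fun h => hm.2 (h.mul_left _)⟩⟩
            · intros; positivity
          · rintro ⟨m, d⟩ hx ⟨m', d'⟩ hx' heq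
            simp only [Finset.coe_sigma, Set.mem_sigma_iff, Finset.mem_coe, Nat.mem_divisors] at hx hx'
            simp only [Prod.mk.injEq] at heq
            obtain ⟨rfl, h2⟩ := heq
            have : m = m' := by
              rw [← Nat.div_mul_cancel hx.2.1, ← Nat.div_mul_cancel hx'.2.1, h2]
            subst this
            rfl
      _ = _ := by
          rw [Finset.sum_product, hT, Finset.sum_mul_sum]
  nlinarith

/-- Combined lower bound. -/
lemma totient_lower (p K : ℕ) (hp : p.Prime) (hK : 4 ≤ K) :
    (K : ℝ) / 8 ≤ ∑ m ∈ dens p (p ^ K), (Nat.totient m : ℝ) / (m : ℝ) ^ 2 := by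
  refine le_trans ?_ (sum_totient_dens_ge p (p ^ K))
  set Y := p ^ K / 2 with hY
  have h1 : ∑ m ∈ dens p (2 * Y), (1 : ℝ) / m ≤ ∑ m ∈ dens p (p ^ K), (1 : ℝ) / m := by
    apply Finset.sum_le_sum_of_subset_of_nonneg
    · intro m hm
      rw [mem_dens] at *
      exact ⟨by omega, hm.2⟩
    · intros; positivity
  have h2 := sum_inv_dens_ge p Y hp
  have h3 : (K : ℝ) / 2 ≤ Real.log (Y + 1) := by
    have h4 : ((2 : ℝ) ^ (K - 1)) ≤ Y + 1 := by
      have h5 : 2 ^ K ≤ p ^ K := Nat.pow_le_pow_left hp.two_le K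
      have h6 : 2 ^ (K - 1) ≤ Y + 1 := by
        obtain ⟨k, rfl⟩ : ∃ k, K = k + 1 := ⟨K - 1, by omega⟩
        rw [pow_succ] at h5
        simp only [Nat.add_sub_cancel]
        omega
      exact_mod_cast h6
    have h7 := Real.log_le_log (by positivity) h4
    rw [Real.log_pow] at h7
    have h8 := Real.log_two_gt_d9
    have h9 : ((K - 1 : ℕ) : ℝ) = K - 1 := by rw [Nat.cast_sub (by omega)]; simp
    rw [h9] at h7
    have h10 : (4 : ℝ) ≤ K := by exact_mod_cast hK
    nlinarith
  linarith

/-- the zone constant -/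
noncomputable def c1 (p : ℕ) : ℝ := 1 / (128 * (p : ℝ) ^ 2)

lemma c1_pos {p : ℕ} (hp : p.Prime) : 0 < c1 p := by
  have : (0 : ℝ) < p := by exact_mod_cast hp.pos
  unfold c1; positivity

lemma c1_le_one {p : ℕ} (hp : p.Prime) : c1 p ≤ 1 := by
  have : (1 : ℝ) ≤ p := by exact_mod_cast hp.one_lt.le
  unfold c1
  rw [div_le_one (by positivity)]
  nlinarith

/-- the zone at stage `K`, over the period interval `b` -/
def zone (p K b : ℕ) : Set ℝ :=
  {α | ∃ κ m a : ℕ, 1 ≤ κ ∧ κ ≤ K ∧ 1 ≤ m ∧ m ≤ p ^ K ∧ ¬ p ∣ m ∧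
    b * (p ^ κ * m) ≤ a ∧ a < (b + 1) * (p ^ κ * m) ∧
    |α - (a : ℝ) / (p ^ K * (p ^ κ * m))| ≤ c1 p / (p ^ K * (p ^ κ * m) * m * (K : ℝ) ^ 2)}

lemma zone_measure (p K b : ℕ) (hp : p.Prime) (hK : 4 ≤ K) :
    ENNReal.ofReal (c1 p / 16 / p ^ K) ≤ volume (zone p K b) := by
  classical
  have hp0 : (0 : ℝ) < p := by exact_mod_cast hp.pos
  have hc1 := c1_pos hp
  have hK0 : (4 : ℝ) ≤ K := by exact_mod_cast hK
  let E : Finset (ℕ × ℕ) := Finset.Icc 1 K ×ˢ dens p (p ^ K)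
  let Q : ℕ × ℕ → ℕ := fun e => p ^ e.1 * e.2
  let A : ℕ × ℕ → Finset ℕ := fun e => (Finset.Ico (b * Q e) (b * Q e + Q e)).filter (fun a => (Q e).Coprime a)
  let r : ℕ × ℕ → ℝ := fun e => c1 p / (p ^ K * (Q e : ℝ) * e.2 * (K : ℝ) ^ 2)
  let I : Finset ((_ : ℕ × ℕ) × ℕ) := E.sigma A
  let Bl : ((_ : ℕ × ℕ) × ℕ) → Set ℝ := fun i => Metric.closedBall ((i.2 : ℝ) / (p ^ K * (Q i.1 : ℝ))) (r i.1)
  have hE : ∀ e ∈ E, 1 ≤ e.1 ∧ e.1 ≤ K ∧ 1 ≤ e.2 ∧ e.2 ≤ p ^ K ∧ ¬ p ∣ e.2 := by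
    intro e he
    simp only [E, Finset.mem_product, Finset.mem_Icc, mem_dens] at he
    tauto
  have hQ : ∀ e ∈ E, 0 < Q e := by
    intro e he
    have := hE e he
    exact Nat.mul_pos (pow_pos hp.pos _) (by omega)
  have hr : ∀ e ∈ E, 0 < r e := by
    intro e he
    have h1 : (0 : ℝ) < Q e := by exact_mod_cast hQ e he
    have h2 : (0 : ℝ) < e.2 := by exact_mod_cast (hE e he).2.2.1
    simp only [r]
    positivity
  have hsub : (⋃ i ∈ I, Bl i) ⊆ zone p K b := by
    intro α hα
    simp only [Set.mem_iUnion] at hα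
    obtain ⟨⟨e, a⟩, hi, hb⟩ := hα
    simp only [I, Finset.mem_sigma, A, Finset.mem_filter, Finset.mem_Ico] at hi
    obtain ⟨he, ⟨h1, h2⟩, h3⟩ := hi
    have h4 := hE e he
    refine ⟨e.1, e.2, a, h4.1, h4.2.1, h4.2.2.1, h4.2.2.2.1, h4.2.2.2.2, h1, ?_, ?_⟩
    · rw [add_mul, one_mul]; exact h2
    · simp only [Bl, Metric.mem_closedBall, Real.dist_eq, r, Q] at hb
      push_cast at hb
      exact hb
  refine le_trans ?_ (measure_mono hsub)
  have hbon := bonf I Bl (fun i => measurableSet_closedBall)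
  -- main term
  have hmain : ENNReal.ofReal (c1 p / 8 / p ^ K) ≤ ∑ i ∈ I, volume (Bl i) := by
    have h1 : ∑ i ∈ I, volume (Bl i) = ENNReal.ofReal (∑ i ∈ I, 2 * r i.1) := by
      rw [ENNReal.ofReal_sum_of_nonneg]
      · apply Finset.sum_congr rfl
        intro i hi
        simp only [Bl, Real.volume_closedBall]
      · intro i hi
        have := hr i.1 (Finset.mem_sigma.1 hi).1
        positivity
    rw [h1]
    apply ENNReal.ofReal_le_ofReal
    rw [Finset.sum_sigma]
    simp only [Finset.sum_const, nsmul_eq_mul]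
    have h2 : ∀ e ∈ E, c1 p / (p ^ K * (K : ℝ) ^ 2) * ((Nat.totient e.2 : ℝ) / (e.2 : ℝ) ^ 2)
        ≤ ((A e).card : ℝ) * (2 * r e) := by
      intro e he
      have h3 := hE e he
      have h4 : (A e).card = Nat.totient (Q e) := Nat.filter_coprime_Ico_eq_totient _ _
      have hcop : Nat.Coprime (p ^ e.1) e.2 := Nat.Coprime.pow_left _ ((Nat.Prime.coprime_iff_not_dvd hp).2 h3.2.2.2.2)
      have h5 : (p : ℝ) ^ e.1 * Nat.totient e.2 ≤ 2 * ((A e).card : ℝ) := by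
        rw [h4]
        simp only [Q]
        rw [Nat.totient_mul hcop]
        obtain ⟨k, hk⟩ : ∃ k, e.1 = k + 1 := ⟨e.1 - 1, by omega⟩
        rw [hk, Nat.totient_prime_pow_succ hp]
        have h6 : p ≤ 2 * (p - 1) := by have := hp.two_le; omega
        have h7 : (p : ℝ) ≤ 2 * ((p - 1 : ℕ) : ℝ) := by exact_mod_cast h6
        rw [Nat.cast_mul, Nat.cast_mul, pow_succ]
        push_cast
        calc (p : ℝ) ^ k * p * Nat.totient e.2 ≤ (p : ℝ) ^ k * (2 * ((p - 1 : ℕ) : ℝ)) * Nat.totient e.2 := by gcongr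
          _ = _ := by ring
      have h8 : (0 : ℝ) < e.2 := by exact_mod_cast h3.2.2.1
      have h9 : r e = c1 p / (p ^ K * ((p : ℝ) ^ e.1 * e.2) * e.2 * (K : ℝ) ^ 2) := by
        simp only [r, Q]; push_cast; rfl
      rw [h9]
      calc c1 p / (p ^ K * (K : ℝ) ^ 2) * ((Nat.totient e.2 : ℝ) / (e.2 : ℝ) ^ 2)
          = (c1 p / (p ^ K * ((p : ℝ) ^ e.1 * e.2) * e.2 * (K : ℝ) ^ 2)) * ((p : ℝ) ^ e.1 * Nat.totient e.2) := by
            field_simp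
        _ ≤ (c1 p / (p ^ K * ((p : ℝ) ^ e.1 * e.2) * e.2 * (K : ℝ) ^ 2)) * (2 * ((A e).card : ℝ)) := by gcongr
        _ = _ := by ring
    refine le_trans ?_ (Finset.sum_le_sum h2)
    rw [← Finset.mul_sum]
    simp only [E]
    rw [Finset.sum_product]
    simp only [Finset.sum_const, nsmul_eq_mul, Nat.card_Icc, Nat.add_sub_cancel]
    have h10 := totient_lower p K hp hK
    calc c1 p / 8 / p ^ K = c1 p / (p ^ K * (K : ℝ) ^ 2) * (K * (K / 8)) := by field_simp
      _ ≤ _ := by gcongr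
  -- pairs
  have hpairs : ∑ q ∈ I.offDiag, volume (Bl q.1 ∩ Bl q.2) ≤ ENNReal.ofReal (c1 p / 16 / p ^ K) := by
    let G : ((_ : ℕ × ℕ) × ℕ) → ((_ : ℕ × ℕ) × ℕ) → ℝ := fun i j =>
      if i.2 * Q j.1 ≠ j.2 * Q i.1 ∧ |(i.2 : ℝ) / Q i.1 - (j.2 : ℝ) / Q j.1| ≤ p ^ K * (r i.1 + r j.1)
      then 2 * min (r i.1) (r j.1) else 0
    have hG0 : ∀ i ∈ I, ∀ j ∈ I, 0 ≤ G i j := by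
      intro i hi j hj
      have h1 := hr i.1 (Finset.mem_sigma.1 hi).1
      have h2 := hr j.1 (Finset.mem_sigma.1 hj).1
      simp only [G]
      split_ifs
      · positivity
      · exact le_rfl
    have hvol : ∀ q ∈ I.offDiag, volume (Bl q.1 ∩ Bl q.2) ≤ ENNReal.ofReal (G q.1 q.2) := by
      rintro ⟨⟨e, a⟩, ⟨e', a'⟩⟩ hq
      simp only [Finset.mem_offDiag, I, Finset.mem_sigma, A, Finset.mem_filter] at hq
      obtain ⟨⟨he, ha, hca⟩, ⟨he', ha', hca'⟩, hne⟩ := hq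
      by_cases hemp : (Bl ⟨e, a⟩ ∩ Bl ⟨e', a'⟩).Nonempty
      swap
      · rw [Set.not_nonempty_iff_eq_empty] at hemp
        simp [hemp]
      · have hcond : a * Q e' ≠ a' * Q e ∧ |(a : ℝ) / Q e - (a' : ℝ) / Q e'| ≤ p ^ K * (r e + r e') := by
          constructor
          · intro h
            apply hne
            have hd1 : Q e ∣ Q e' := hca.dvd_of_dvd_mul_left ⟨a', by rw [h, mul_comm]⟩
            have hd2 : Q e' ∣ Q e := hca'.dvd_of_dvd_mul_left ⟨a, by rw [← h, mul_comm]⟩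
            have hQQ := Nat.dvd_antisymm hd1 hd2
            have haa : a = a' := by
              rw [hQQ] at h
              exact Nat.eq_of_mul_eq_mul_right (hQ e' he') h
            have h3 := hE e he
            have h3' := hE e' he'
            have hv : e.1 = e'.1 := by
              have hx : ∀ f ∈ E, (Q f).factorization p = f.1 := by
                intro f hf
                have h4 := hE f hf
                simp only [Q]
                rw [Nat.factorization_mul (pow_pos hp.pos _).ne' (by omega)]
                simp [hp.factorization_self, Nat.factorization_eq_zero_of_not_dvd h4.2.2.2.2]
              rw [← hx e he, ← hx e' he', hQQ]
            have hm : e.2 = e'.2 := by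
              simp only [Q] at hQQ
              rw [hv] at hQQ
              exact Nat.eq_of_mul_eq_mul_left (pow_pos hp.pos _) hQQ
            have : e = e' := Prod.ext hv hm
            subst this
            subst haa
            rfl
          · obtain ⟨z, hz1, hz2⟩ := hemp
            simp only [Bl, Metric.mem_closedBall] at hz1 hz2
            have h1 : dist ((a : ℝ) / (p ^ K * (Q e : ℝ))) ((a' : ℝ) / (p ^ K * (Q e' : ℝ))) ≤ r e + r e' := by
              refine (dist_triangle_left _ _ z).trans (add_le_add hz1 hz2)
            rw [Real.dist_eq] at h1
            have h2 : (a : ℝ) / Q e - (a' : ℝ) / Q e' =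
                p ^ K * ((a : ℝ) / (p ^ K * (Q e : ℝ)) - (a' : ℝ) / (p ^ K * (Q e' : ℝ))) := by
              have h5 : (0 : ℝ) < Q e := by exact_mod_cast hQ e he
              have h6 : (0 : ℝ) < Q e' := by exact_mod_cast hQ e' he'
              field_simp
            rw [h2, abs_mul, abs_of_pos (by positivity : (0 : ℝ) < p ^ K)]
            gcongr
        have : G ⟨e, a⟩ ⟨e', a'⟩ = 2 * min (r e) (r e') := by
          simp only [G]; rw [if_pos hcond]
        simp only [this]
        rcases le_total (r e) (r e') with h | h
        · rw [min_eq_left h]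
          refine (measure_mono Set.inter_subset_left).trans ?_
          simp only [Bl, Real.volume_closedBall, mul_comm]
          exact le_rfl
        · rw [min_eq_right h]
          refine (measure_mono Set.inter_subset_right).trans ?_
          simp only [Bl, Real.volume_closedBall, mul_comm]
          exact le_rfl
    refine (Finset.sum_le_sum hvol).trans ?_
    rw [← ENNReal.ofReal_sum_of_nonneg (by
      intro q hq
      rw [Finset.mem_offDiag] at hq
      exact hG0 _ hq.1 _ hq.2.1)]
    apply ENNReal.ofReal_le_ofReal
    have hS1 : ∑ q ∈ I.offDiag, G q.1 q.2 ≤ ∑ i ∈ I, ∑ j ∈ I, G i j := by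
      rw [← Finset.sum_product']
      apply Finset.sum_le_sum_of_subset_of_nonneg
      · intro q hq
        rw [Finset.mem_offDiag] at hq
        exact Finset.mem_product.2 ⟨hq.1, hq.2.1⟩
      · intro q hq _
        rw [Finset.mem_product] at hq
        exact hG0 _ hq.1 _ hq.2
    have hS2 : ∑ i ∈ I, ∑ j ∈ I, G i j = ∑ e ∈ E, ∑ e' ∈ E, ∑ a ∈ A e, ∑ a' ∈ A e', G ⟨e, a⟩ ⟨e', a'⟩ := by
      simp only [I, Finset.sum_sigma]
      apply Finset.sum_congr rfl
      intro e _
      rw [Finset.sum_comm]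
    have hS3 : ∀ e ∈ E, ∀ e' ∈ E, ∑ a ∈ A e, ∑ a' ∈ A e', G ⟨e, a⟩ ⟨e', a'⟩
        ≤ 8 * c1 p ^ 2 / (p ^ K * (K : ℝ) ^ 4) * ((1 / (e.2 : ℝ)) * (1 / (e'.2 : ℝ))) := by
      intro e he e' he'
      have hre := hr e he
      have hre' := hr e' he'
      rw [← Finset.sum_product']
      have h1 := count_pairs (Q e) (Q e') b (hQ e he) (hQ e' he') (p ^ K * (r e + r e')) (by positivity)
      have hmin : 0 ≤ min (r e) (r e') := by positivity
      calc ∑ x ∈ A e ×ˢ A e', G ⟨e, x.1⟩ ⟨e', x.2⟩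
          ≤ ∑ x ∈ Finset.Ico (b * Q e) ((b + 1) * Q e) ×ˢ Finset.Ico (b * Q e') ((b + 1) * Q e'),
              G ⟨e, x.1⟩ ⟨e', x.2⟩ := by
            apply Finset.sum_le_sum_of_subset_of_nonneg
            · apply Finset.product_subset_product
              · simp only [A, add_mul, one_mul]; exact Finset.filter_subset _ _
              · simp only [A, add_mul, one_mul]; exact Finset.filter_subset _ _
            · intro x _ _
              simp only [G]
              split_ifs
              · positivity
              · exact le_rfl
        _ = _ * (2 * min (r e) (r e')) := by
            simp only [G]
            rw [← Finset.sum_filter, Finset.sum_const, nsmul_eq_mul]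
        _ ≤ (2 * (p ^ K * (r e + r e')) * Q e * Q e') * (2 * min (r e) (r e')) := by
            gcongr
        _ = (4 * p ^ K * Q e * Q e') * ((r e + r e') * min (r e) (r e')) := by ring
        _ ≤ (4 * p ^ K * Q e * Q e') * (2 * (r e * r e')) := by
            refine mul_le_mul_of_nonneg_left ?_ (by positivity)
            rcases le_total (r e) (r e') with h | h
            · rw [min_eq_left h]; nlinarith
            · rw [min_eq_right h]; nlinarith
        _ = _ := by
            have h5 : (0 : ℝ) < Q e := by exact_mod_cast hQ e he
            have h6 : (0 : ℝ) < Q e' := by exact_mod_cast hQ e' he'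
            have h7 : (0 : ℝ) < e.2 := by exact_mod_cast (hE e he).2.2.1
            have h8 : (0 : ℝ) < e'.2 := by exact_mod_cast (hE e' he').2.2.1
            simp only [r]
            field_simp
            ring
    rw [hS2] at hS1
    refine hS1.trans ((Finset.sum_le_sum (fun e he => Finset.sum_le_sum (fun e' he' => hS3 e he e' he'))).trans ?_)
    simp only [← Finset.mul_sum]
    rw [← Finset.sum_mul]
    have hsumE : ∑ e ∈ E, 1 / (e.2 : ℝ) ≤ p * (K : ℝ) ^ 2 := by
      simp only [E]
      rw [Finset.sum_product]
      simp only [Finset.sum_const, nsmul_eq_mul, Nat.card_Icc, Nat.add_sub_cancel]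
      have h1 := sum_inv_dens_le p (p ^ K)
      push_cast at h1
      rw [Real.log_pow] at h1
      have h2 := Real.log_le_sub_one_of_pos hp0
      calc (K : ℝ) * ∑ m ∈ dens p (p ^ K), 1 / (m : ℝ) ≤ K * (1 + K * (p - 1)) := by
            gcongr
            exact h1.trans (by gcongr)
        _ ≤ _ := by nlinarith
    have hsum0 : 0 ≤ ∑ e ∈ E, 1 / (e.2 : ℝ) := Finset.sum_nonneg (fun _ _ => by positivity)
    calc 8 * c1 p ^ 2 / (p ^ K * (K : ℝ) ^ 4) * ((∑ e ∈ E, 1 / (e.2 : ℝ)) * ∑ e ∈ E, 1 / (e.2 : ℝ))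
        ≤ 8 * c1 p ^ 2 / (p ^ K * (K : ℝ) ^ 4) * ((p * (K : ℝ) ^ 2) * (p * (K : ℝ) ^ 2)) := by gcongr
      _ = c1 p / 16 / p ^ K := by
          simp only [c1]
          field_simp
          norm_num
  have hfin : ENNReal.ofReal (c1 p / 16 / p ^ K) + ENNReal.ofReal (c1 p / 16 / p ^ K)
      ≤ volume (⋃ i ∈ I, Bl i) + ENNReal.ofReal (c1 p / 16 / p ^ K) := by
    rw [← ENNReal.ofReal_add (by positivity) (by positivity)]
    calc _ = ENNReal.ofReal (c1 p / 8 / p ^ K) := by congr 1; ring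
      _ ≤ _ := hmain
      _ ≤ _ := hbon
      _ ≤ _ := by gcongr
  exact (ENNReal.add_le_add_iff_right ENNReal.ofReal_ne_top).1 hfin

/-- points of `ℝ` within `δ` of `S` -/
def nearS (S : Set ℝ) (δ : ℝ) : Set ℝ := {α | ∃ x ∈ S, |x - α| ≤ δ}

lemma nearS_eq (S : Set ℝ) (δ : ℝ) : nearS S δ = ⋃ x ∈ S, Metric.closedBall x δ := by
  ext α
  simp only [nearS, Set.mem_ofPred_eq, Set.mem_iUnion, Metric.mem_closedBall, Real.dist_eq, exists_prop]
  simp only [abs_sub_comm]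

lemma measurableSet_nearS (S : Set ℝ) (hS : S.Countable) (δ : ℝ) : MeasurableSet (nearS S δ) := by
  rw [nearS_eq]
  exact MeasurableSet.biUnion hS (fun x _ => Metric.isClosed_closedBall.measurableSet)

lemma sep_measure (S : Set ℝ) (σ : ℝ) (hσ : 0 < σ)
    (hS : ∀ x ∈ S, ∀ y ∈ S, x ≠ y → σ ≤ |x - y|) (z L δ : ℝ) (hL : 0 ≤ L) (hδ : 0 ≤ δ) :
    volume (Metric.closedBall z L ∩ nearS S δ) ≤
      ENNReal.ofReal (2 * δ * ((2 * L + 2 * δ) / σ + 1)) := by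
  classical
  set T : Set ℝ := S ∩ Set.Icc (z - L - δ) (z + L + δ) with hT
  set N : ℕ := ⌊(2 * L + 2 * δ) / σ⌋₊ + 1 with hN
  let f : ℝ → ℕ := fun x => ⌊(x - (z - L - δ)) / σ⌋₊
  have hmaps : Set.MapsTo f T (Finset.range N : Finset ℕ) := by
    intro x hx
    simp only [Finset.coe_range, Set.mem_Iio, hN, f]
    apply Nat.lt_succ_of_le
    apply Nat.floor_le_floor
    have := hx.2.2
    gcongr
    linarith
  have hinj : Set.InjOn f T := by
    intro x hx y hy hxy
    by_contra hne
    have h1 := hS x hx.1 y hy.1 hne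
    simp only [f] at hxy
    have hx0 : 0 ≤ (x - (z - L - δ)) / σ := div_nonneg (by linarith [hx.2.1]) hσ.le
    have hy0 : 0 ≤ (y - (z - L - δ)) / σ := div_nonneg (by linarith [hy.2.1]) hσ.le
    have a1 := Nat.floor_le hx0
    have a2 := Nat.lt_floor_add_one ((x - (z - L - δ)) / σ)
    have b1 := Nat.floor_le hy0
    have b2 := Nat.lt_floor_add_one ((y - (z - L - δ)) / σ)
    rw [hxy] at a1 a2
    have h3 : |(x - (z - L - δ)) / σ - (y - (z - L - δ)) / σ| < 1 := by
      rw [abs_lt]; constructor <;> linarith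
    rw [← sub_div, abs_div, abs_of_pos hσ, div_lt_one hσ] at h3
    have : x - (z - L - δ) - (y - (z - L - δ)) = x - y := by ring
    rw [this] at h3
    linarith
  have hfin : T.Finite := Set.Finite.of_finite_image ((Finset.finite_toSet _).subset hmaps.image_subset) hinj
  have hcard : hfin.toFinset.card ≤ N := by
    have := Finset.card_le_card_of_injOn (s := hfin.toFinset) (t := Finset.range N) f
      (by intro x hx; exact hmaps (by simpa using hx)) (by simpa using hinj)
    simpa using this
  have hsub : Metric.closedBall z L ∩ nearS S δ ⊆ ⋃ x ∈ hfin.toFinset, Metric.closedBall x δ := by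
    rintro α ⟨h1, x, hx, h2⟩
    rw [Metric.mem_closedBall, Real.dist_eq] at h1
    simp only [Set.mem_iUnion]
    refine ⟨x, ?_, by rw [Metric.mem_closedBall, Real.dist_eq, abs_sub_comm]; exact h2⟩
    rw [Set.Finite.mem_toFinset]
    rw [abs_le] at h1 h2
    exact ⟨hx, by linarith, by linarith⟩
  refine (measure_mono hsub).trans ((measure_biUnion_finset_le _ _).trans ?_)
  simp only [Real.volume_closedBall, Finset.sum_const, nsmul_eq_mul]
  rw [← ENNReal.ofReal_natCast, ← ENNReal.ofReal_mul (by positivity)]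
  apply ENNReal.ofReal_le_ofReal
  have h4 : (hfin.toFinset.card : ℝ) ≤ (2 * L + 2 * δ) / σ + 1 := by
    have h5 : (hfin.toFinset.card : ℝ) ≤ N := by exact_mod_cast hcard
    refine h5.trans ?_
    rw [hN]; push_cast
    have := Nat.floor_le (show 0 ≤ (2 * L + 2 * δ) / σ by positivity)
    linarith
  nlinarith

/-- class of rationals with denominators `p^k m`, `m` of dyadic size `2^i` -/
def clsS (p : ℕ) (e : ℕ × ℕ) : Set ℝ :=
  {x | ∃ (a : ℤ) (m : ℕ), 2 ^ e.2 ≤ m ∧ m < 2 ^ (e.2 + 1) ∧ x = a / ((p : ℝ) ^ e.1 * m)}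

lemma clsS_countable (p : ℕ) (e : ℕ × ℕ) : (clsS p e).Countable := by
  apply (Set.countable_range (fun q : ℤ × ℕ => (q.1 : ℝ) / ((p : ℝ) ^ e.1 * q.2))).mono
  rintro x ⟨a, m, _, _, rfl⟩
  exact ⟨(a, m), rfl⟩

/-- height of a class -/
def hgt (p : ℕ) (e : ℕ × ℕ) : ℕ := p ^ e.1 * 4 ^ e.2

lemma hgt_pos {p : ℕ} (hp : p.Prime) (e : ℕ × ℕ) : 0 < hgt p e := by
  have := hp.pos
  unfold hgt; positivity

lemma clsS_sep {p : ℕ} (hp : p.Prime) (e : ℕ × ℕ) :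
    ∀ x ∈ clsS p e, ∀ y ∈ clsS p e, x ≠ y → 1 / (4 * (hgt p e : ℝ)) ≤ |x - y| := by
  rintro x ⟨a, m, h1, h2, rfl⟩ y ⟨b, n, h3, h4, rfl⟩ hne
  have hp0 : (0 : ℝ) < p := by exact_mod_cast hp.pos
  have hm : (0 : ℝ) < m := by exact_mod_cast lt_of_lt_of_le (by positivity) h1
  have hn : (0 : ℝ) < n := by exact_mod_cast lt_of_lt_of_le (by positivity) h3
  have heq : (a : ℝ) / ((p : ℝ) ^ e.1 * m) - b / ((p : ℝ) ^ e.1 * n)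
      = ((a * n - b * m : ℤ) : ℝ) / ((p : ℝ) ^ e.1 * m * n) := by
    push_cast; field_simp
  have hz : (a * n - b * m : ℤ) ≠ 0 := by
    intro h
    rw [h] at heq
    simp only [Int.cast_zero, zero_div] at heq
    exact hne (sub_eq_zero.mp heq)
  rw [heq, abs_div, abs_of_pos (show 0 < (p : ℝ) ^ e.1 * m * n by positivity)]
  have h5 : (1 : ℝ) ≤ |((a * n - b * m : ℤ) : ℝ)| := by
    rw [← Int.cast_abs]; exact_mod_cast Int.one_le_abs hz
  have h6 : (p : ℝ) ^ e.1 * m * n ≤ 4 * hgt p e := by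
    have h2' : (m : ℝ) ≤ 2 ^ (e.2 + 1) := by exact_mod_cast h2.le
    have h4' : (n : ℝ) ≤ 2 ^ (e.2 + 1) := by exact_mod_cast h4.le
    unfold hgt
    push_cast
    calc (p : ℝ) ^ e.1 * m * n ≤ (p : ℝ) ^ e.1 * 2 ^ (e.2 + 1) * 2 ^ (e.2 + 1) := by gcongr
      _ = _ := by
        rw [show (4 : ℝ) = 2 ^ 2 by norm_num, ← pow_mul]; ring
  gcongr

/-- the classes treated at stage `K` -/
def cls (p K : ℕ) : Finset (ℕ × ℕ) :=
  ((Finset.range (5 * K + 1)) ×ˢ (Finset.range (5 * K * p + 1))).filter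
    (fun e => p ^ K < 256 * hgt p e ∧ 256 * hgt p e ≤ p ^ (5 * K))

lemma mem_cls {p K : ℕ} (hp : p.Prime) {e : ℕ × ℕ} :
    e ∈ cls p K ↔ p ^ K < 256 * hgt p e ∧ 256 * hgt p e ≤ p ^ (5 * K) := by
  unfold cls
  rw [Finset.mem_filter, and_iff_right_iff_imp]
  rintro ⟨_, h⟩
  have h4 : 0 < 4 ^ e.2 := by positivity
  have h5 : 0 < p ^ e.1 := pow_pos hp.pos _
  simp only [Finset.mem_product, Finset.mem_range, Nat.lt_succ_iff]
  constructor
  · apply (Nat.pow_le_pow_iff_right hp.one_lt).mp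
    refine le_trans ?_ h
    unfold hgt
    nlinarith
  · apply (Nat.pow_le_pow_iff_right (a := 2) (by norm_num)).mp
    calc 2 ^ e.2 ≤ 4 ^ e.2 := Nat.pow_le_pow_left (by norm_num) _
      _ ≤ 256 * hgt p e := by unfold hgt; nlinarith
      _ ≤ p ^ (5 * K) := h
      _ ≤ (2 ^ p) ^ (5 * K) := Nat.pow_le_pow_left Nat.lt_two_pow_self.le _
      _ = _ := by rw [← pow_mul]; ring_nf

lemma card_cls {p K : ℕ} (hp : p.Prime) (hK : 1 ≤ K) : ((cls p K).card : ℝ) ≤ 36 * p * (K : ℝ) ^ 2 := by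
  have h1 : (cls p K).card ≤ (5 * K + 1) * (5 * K * p + 1) := by
    refine (Finset.card_filter_le _ _).trans ?_
    rw [Finset.card_product, Finset.card_range, Finset.card_range]
  have h2 : (5 * K + 1) * (5 * K * p + 1) ≤ (6 * K) * (6 * K * p) := by
    have := hp.pos
    apply Nat.mul_le_mul
    · omega
    · nlinarith
  have h3 : ((cls p K).card : ℝ) ≤ ((6 * K) * (6 * K * p) : ℕ) := by exact_mod_cast h1.trans h2
  refine h3.trans (le_of_eq ?_)
  push_cast; ring

/-- radius of a class -/
noncomputable def rho (p : ℕ) (c : ℝ) (K : ℕ) (e : ℕ × ℕ) : ℝ := c / (hgt p e * (K : ℝ) ^ 2)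

lemma rho_pos {p : ℕ} (hp : p.Prime) {c : ℝ} (hc : 0 < c) {K : ℕ} (hK : 1 ≤ K) (e : ℕ × ℕ) :
    0 < rho p c K e := by
  have : (0 : ℝ) < hgt p e := by exact_mod_cast hgt_pos hp e
  have : (0 : ℝ) < K := by exact_mod_cast hK
  unfold rho; positivity

/-- the weight function at scale `l` -/
noncomputable def Wf (p : ℕ) (c : ℝ) (K : ℕ) (C : Finset (ℕ × ℕ)) (l : ℝ) (α : ℝ) : ENNReal :=
  ∑ e ∈ C, (nearS (clsS p e) (rho p c K e + l)).indicator
    (fun _ => ENNReal.ofReal (rho p c K e / (rho p c K e + l))) α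

lemma measurable_Wf (p : ℕ) (c : ℝ) (K : ℕ) (C : Finset (ℕ × ℕ)) (l : ℝ) : Measurable (Wf p c K C l) := by
  unfold Wf
  apply Finset.measurable_sum
  intro e _
  exact measurable_const.indicator (measurableSet_nearS _ (clsS_countable p e) _)

/-- scale at stage `K` -/
noncomputable def ell (p K : ℕ) : ℝ := 8 / (p : ℝ) ^ K

lemma ell_pos {p : ℕ} (hp : p.Prime) (K : ℕ) : 0 < ell p K := by
  have : (0 : ℝ) < p := by exact_mod_cast hp.pos
  unfold ell; positivity

lemma new_measure {p K : ℕ} (hp : p.Prime) (hK : 1 ≤ K) {c κ : ℝ} (hc : 0 < c) (hc' : c ≤ 1 / 32)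
    (hκ : 0 < κ) (z : ℝ) :
    volume (Metric.closedBall z (ell p K / 2) ∩
      {α | ENNReal.ofReal κ ≤ Wf p c K (cls p K) (ell p (5 * K)) α}) ≤
      ENNReal.ofReal (36000 * p * c / κ / p ^ K) := by
  have hp0 : (0 : ℝ) < p := by exact_mod_cast hp.pos
  have hp1 : (1 : ℝ) ≤ p := by exact_mod_cast hp.one_lt.le
  have hK0 : (1 : ℝ) ≤ K := by exact_mod_cast hK
  have hl := ell_pos hp K
  have hl' := ell_pos hp (5 * K)
  set I := Metric.closedBall z (ell p K / 2) with hI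
  have hcls : ∀ e ∈ cls p K, ∫⁻ α in I, (nearS (clsS p e) (rho p c K e + ell p (5 * K))).indicator
      (fun _ => ENNReal.ofReal (rho p c K e / (rho p c K e + ell p (5 * K)))) α
      ≤ ENNReal.ofReal (1000 * c / (K : ℝ) ^ 2 / p ^ K) := by
    intro e he
    rw [mem_cls hp] at he
    have hh : (0 : ℝ) < hgt p e := by exact_mod_cast hgt_pos hp e
    have he1 : (p : ℝ) ^ K ≤ 256 * hgt p e := by exact_mod_cast he.1.le
    have he2 : 256 * (hgt p e : ℝ) ≤ p ^ (5 * K) := by exact_mod_cast he.2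
    have hr := rho_pos hp hc hK e
    set ρ := rho p c K e with hρ
    set l' := ell p (5 * K) with hl'def
    rw [lintegral_indicator (measurableSet_nearS _ (clsS_countable p e) _), lintegral_const,
      Measure.restrict_apply_univ, Measure.restrict_apply (measurableSet_nearS _ (clsS_countable p e) _)]
    have h1 := sep_measure (clsS p e) (1 / (4 * (hgt p e : ℝ))) (by positivity) (clsS_sep hp e)
      z (ell p K / 2) (ρ + l') (by positivity) (by positivity)
    rw [Set.inter_comm]
    refine (mul_le_mul_right h1 _).trans ?_
    rw [← ENNReal.ofReal_mul (by positivity)]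
    apply ENNReal.ofReal_le_ofReal
    have hrh : ρ * hgt p e = c / (K : ℝ) ^ 2 := by
      rw [hρ]; unfold rho; field_simp
    have hrh2 : ρ * hgt p e ≤ 1 / 32 := by
      rw [hrh]
      refine le_trans (div_le_self hc.le ?_) hc'
      nlinarith
    have hlh : l' * hgt p e ≤ 1 / 32 := by
      rw [hl'def]; unfold ell
      rw [div_mul_eq_mul_div, div_le_iff₀ (by positivity)]
      linarith
    have hlK : ell p K * p ^ K = 8 := by unfold ell; field_simp
    have h3 : ρ / (ρ + l') * (2 * (ρ + l') * ((2 * (ell p K / 2) + 2 * (ρ + l')) / (1 / (4 * (hgt p e : ℝ))) + 1))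
        = 2 * ρ * ((ell p K + 2 * (ρ + l')) * (4 * hgt p e) + 1) := by
      have : ρ + l' ≠ 0 := by positivity
      field_simp
    rw [h3, le_div_iff₀ (by positivity), show 1000 * c / (K : ℝ) ^ 2 = 1000 * (c / (K : ℝ) ^ 2) by ring, ← hrh]
    have h4 : (ell p K + 2 * (ρ + l')) * (4 * hgt p e) + 1 ≤ ell p K * (4 * hgt p e) + 3 / 2 := by
      nlinarith
    have h5 : (ell p K * (4 * hgt p e) + 3 / 2) * p ^ K ≤ 500 * hgt p e := by
      have : (ell p K * (4 * hgt p e) + 3 / 2) * p ^ K = 4 * hgt p e * (ell p K * p ^ K) + 3 / 2 * p ^ K := by ring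
      rw [this, hlK]
      linarith
    have h6 : ((ell p K + 2 * (ρ + l')) * (4 * hgt p e) + 1) * p ^ K ≤ 500 * hgt p e :=
      (mul_le_mul_of_nonneg_right h4 (by positivity)).trans h5
    calc _ = 2 * ρ * (((ell p K + 2 * (ρ + l')) * (4 * hgt p e) + 1) * p ^ K) := by ring
      _ ≤ 2 * ρ * (500 * hgt p e) := by gcongr
      _ = _ := by ring
  have hIntegral : ∫⁻ α in I, Wf p c K (cls p K) (ell p (5 * K)) α ≤ ENNReal.ofReal (36000 * p * c / p ^ K) := by
    unfold Wf
    rw [lintegral_finsetSum _ (fun e _ =>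
      measurable_const.indicator (measurableSet_nearS _ (clsS_countable p e) _))]
    refine (Finset.sum_le_card_nsmul _ _ _ hcls).trans ?_
    rw [nsmul_eq_mul, ← ENNReal.ofReal_natCast, ← ENNReal.ofReal_mul (by positivity)]
    apply ENNReal.ofReal_le_ofReal
    calc ((cls p K).card : ℝ) * (1000 * c / (K : ℝ) ^ 2 / p ^ K) ≤ (36 * p * (K : ℝ) ^ 2) * (1000 * c / (K : ℝ) ^ 2 / p ^ K) := by
          gcongr
          exact card_cls hp hK
      _ = _ := by field_simp; ring
  have hm := meas_ge_le_lintegral_div (μ := volume.restrict I)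
    (measurable_Wf p c K (cls p K) (ell p (5 * K))).aemeasurable
    (ε := ENNReal.ofReal κ) (by simpa using hκ) ENNReal.ofReal_ne_top
  rw [Measure.restrict_apply (measurableSet_le measurable_const (measurable_Wf _ _ _ _ _)), Set.inter_comm] at hm
  refine hm.trans ((ENNReal.div_le_div_right hIntegral _).trans ?_)
  rw [← ENNReal.ofReal_div_of_pos hκ]
  apply ENNReal.ofReal_le_ofReal
  apply le_of_eq
  ring

/-- avoiding old classes -/
lemma old_measure {p K K' : ℕ} (hp : p.Prime) (hK : 1 ≤ K') (hKK : K' ≤ K) {c κ : ℝ} (hc : 0 < c) (hc' : c ≤ 1 / 32)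
    (hκ : 0 < κ) (hκ' : κ ≤ 1 / 2) (C : Finset (ℕ × ℕ)) (hC : ∀ e ∈ C, 256 * hgt p e ≤ p ^ K)
    (hlarge : (K : ℝ) ^ 2 ≤ 32 * c * p ^ (4 * K)) (z : ℝ)
    (hz : Wf p c K' C (ell p K) z < ENNReal.ofReal κ) :
    volume (Metric.closedBall z (ell p K / 2) ∩
      {α | ∃ e ∈ C, α ∈ nearS (clsS p e) (rho p c K' e + ell p (5 * K))}) ≤
      ENNReal.ofReal (128 * κ / p ^ K) := by
  classical
  have hp0 : (0 : ℝ) < p := by exact_mod_cast hp.pos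
  have hp1 : (2 : ℝ) ≤ p := by exact_mod_cast hp.two_le
  have hK0 : (1 : ℝ) ≤ K' := by exact_mod_cast hK
  have hK0' : (K' : ℝ) ≤ K := by exact_mod_cast hKK
  have hl := ell_pos hp K
  have hl' := ell_pos hp (5 * K)
  have hll : ell p (5 * K) ≤ ell p K / 2 := by
    unfold ell
    rw [div_div, div_le_div_iff_of_pos_left (by norm_num) (by positivity) (by positivity)]
    rw [show 5 * K = K + 4 * K by ring, pow_add]
    gcongr
    calc (2 : ℝ) ≤ p := hp1
      _ ≤ p ^ (4 * K) := le_self_pow₀ (by linarith) (by omega)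
  set I := Metric.closedBall z (ell p K / 2) with hI
  have hsub : I ∩ {α | ∃ e ∈ C, α ∈ nearS (clsS p e) (rho p c K' e + ell p (5 * K))} ⊆
      ⋃ e ∈ C, (I ∩ nearS (clsS p e) (rho p c K' e + ell p (5 * K))) := by
    rintro α ⟨h1, e, he, h2⟩
    simp only [Set.mem_iUnion]
    exact ⟨e, he, h1, h2⟩
  refine (measure_mono hsub).trans ((measure_biUnion_finset_le _ _).trans ?_)
  have hterm : ∀ e ∈ C, volume (I ∩ nearS (clsS p e) (rho p c K' e + ell p (5 * K))) ≤
      ENNReal.ofReal (16 * ell p K) * (nearS (clsS p e) (rho p c K' e + ell p K)).indicator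
        (fun _ => ENNReal.ofReal (rho p c K' e / (rho p c K' e + ell p K))) z := by
    intro e he
    have hr := rho_pos hp hc hK e
    have hh : (0 : ℝ) < hgt p e := by exact_mod_cast hgt_pos hp e
    have he2 : 256 * (hgt p e : ℝ) ≤ p ^ K := by exact_mod_cast hC e he
    by_cases hne : (I ∩ nearS (clsS p e) (rho p c K' e + ell p (5 * K))).Nonempty
    · obtain ⟨α, h1, x, hx, h2⟩ := hne
      rw [hI, Metric.mem_closedBall, Real.dist_eq] at h1
      have hmem : z ∈ nearS (clsS p e) (rho p c K' e + ell p K) := by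
        refine ⟨x, hx, ?_⟩
        calc |x - z| = |(x - α) + (α - z)| := by ring_nf
          _ ≤ |x - α| + |α - z| := abs_add_le _ _
          _ ≤ _ := by linarith
      have hw : ENNReal.ofReal (rho p c K' e / (rho p c K' e + ell p K)) < ENNReal.ofReal κ := by
        refine lt_of_le_of_lt ?_ hz
        unfold Wf
        have := Finset.single_le_sum (s := C) (f := fun e => (nearS (clsS p e) (rho p c K' e + ell p K)).indicator
          (fun _ => ENNReal.ofReal (rho p c K' e / (rho p c K' e + ell p K))) z) (fun _ _ => zero_le) he
        rwa [Set.indicator_of_mem hmem] at this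
      rw [ENNReal.ofReal_lt_ofReal_iff hκ, div_lt_iff₀ (by positivity)] at hw
      rw [Set.indicator_of_mem hmem]
      set ρ := rho p c K' e with hρ
      have hρl : ρ ≤ ell p K := by nlinarith
      have h1 := sep_measure (clsS p e) (1 / (4 * (hgt p e : ℝ))) (by positivity) (clsS_sep hp e)
        z (ell p K / 2) (ρ + ell p (5 * K)) (by positivity) (by positivity)
      refine h1.trans ?_
      rw [← ENNReal.ofReal_mul (by positivity)]
      apply ENNReal.ofReal_le_ofReal
      have hrh : ρ * hgt p e = c / (K' : ℝ) ^ 2 := by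
        rw [hρ]; unfold rho; field_simp
      have hrh2 : ρ * hgt p e ≤ 1 / 32 := by
        rw [hrh]
        refine le_trans (div_le_self hc.le ?_) hc'
        nlinarith
      have hlh : ell p K * hgt p e ≤ 1 / 32 := by
        unfold ell
        rw [div_mul_eq_mul_div, div_le_iff₀ (by positivity)]
        linarith
      have hl'ρ : ell p (5 * K) ≤ ρ := by
        rw [hρ]; unfold ell rho
        rw [div_le_div_iff₀ (by positivity) (by positivity)]
        calc 8 * ((hgt p e : ℝ) * (K' : ℝ) ^ 2) ≤ 8 * ((p ^ K / 256) * (K : ℝ) ^ 2) := by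
              gcongr; linarith
          _ ≤ 8 * ((p ^ K / 256) * (32 * c * p ^ (4 * K))) := by gcongr
          _ = c * p ^ (5 * K) := by rw [show 5 * K = K + 4 * K by ring, pow_add]; ring
      have h3 : (2 * (ell p K / 2) + 2 * (ρ + ell p (5 * K))) / (1 / (4 * (hgt p e : ℝ))) ≤ 1 := by
        rw [div_div_eq_mul_div, div_one]
        nlinarith
      calc 2 * (ρ + ell p (5 * K)) * ((2 * (ell p K / 2) + 2 * (ρ + ell p (5 * K))) / (1 / (4 * (hgt p e : ℝ))) + 1)
          ≤ 2 * (ρ + ρ) * (1 + 1) := by gcongr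
        _ = 8 * ρ := by ring
        _ ≤ 16 * ell p K * (ρ / (ρ + ell p K)) := by
          rw [mul_div_assoc', le_div_iff₀ (by positivity)]
          nlinarith
    · rw [Set.not_nonempty_iff_eq_empty] at hne
      rw [hne]; simp
  refine (Finset.sum_le_sum hterm).trans ?_
  rw [← Finset.mul_sum]
  change ENNReal.ofReal (16 * ell p K) * Wf p c K' C (ell p K) z ≤ _
  refine (mul_le_mul_right hz.le _).trans ?_
  rw [← ENNReal.ofReal_mul (by positivity)]
  apply ENNReal.ofReal_le_ofReal
  unfold ell
  apply le_of_eq; ring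

/-- the weighted cover function at scale `l` -/
noncomputable def Uf (y r : ℕ → ℝ) (s l α : ℝ) : ENNReal :=
  ∑' i, (Metric.closedBall (y i) (r i + l)).indicator (fun _ => ENNReal.ofReal (r i ^ s)) α

/-- the small part of the weighted cover function -/
noncomputable def Vf (y r : ℕ → ℝ) (s l α : ℝ) : ENNReal :=
  ∑' i, if r i < l then (Metric.closedBall (y i) (r i + l)).indicator (fun _ => ENNReal.ofReal (r i ^ s)) α else 0

lemma measurable_Vf (y r : ℕ → ℝ) (s l : ℝ) : Measurable (Vf y r s l) := by
  unfold Vf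
  apply Measurable.tsum
  intro i
  split_ifs
  · exact measurable_const.indicator Metric.isClosed_closedBall.measurableSet
  · exact measurable_const

lemma ball_near {z α y r l l' : ℝ} (hll : l' ≤ l / 2) (h1 : α ∈ Metric.closedBall z (l / 2))
    (h2 : α ∈ Metric.closedBall y (r + l')) : z ∈ Metric.closedBall y (r + l) := by
  rw [Metric.mem_closedBall] at *
  have := dist_triangle z α y
  rw [dist_comm] at h1
  linarith

lemma ubig_measure (y r : ℕ → ℝ) (hr : ∀ i, 0 < r i) {s κ l l' z : ℝ} (hs0 : 0 < s) (hs1 : s < 1)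
    (hκ : 0 < κ) (hκ1 : κ ≤ 1) (hl' : 0 < l') (hll : l' ≤ l / 2)
    (hz : Uf y r s l z ≤ ENNReal.ofReal (κ * l ^ s)) :
    volume (Metric.closedBall z (l / 2) ∩ {α | ∃ i, l' ≤ r i ∧ α ∈ Metric.closedBall (y i) (r i + l')})
      ≤ ENNReal.ofReal (4 * κ * l) := by
  have hl : 0 < l := by linarith
  set I := Metric.closedBall z (l / 2) with hI
  have hsub : I ∩ {α | ∃ i, l' ≤ r i ∧ α ∈ Metric.closedBall (y i) (r i + l')} ⊆
      ⋃ i, (I ∩ {α | l' ≤ r i ∧ α ∈ Metric.closedBall (y i) (r i + l')}) := by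
    rintro α ⟨h1, i, h2⟩
    exact Set.mem_iUnion.mpr ⟨i, h1, h2⟩
  refine (measure_mono hsub).trans ((measure_iUnion_le _).trans ?_)
  have hterm : ∀ i, volume (I ∩ {α | l' ≤ r i ∧ α ∈ Metric.closedBall (y i) (r i + l')}) ≤
      ENNReal.ofReal (4 * l ^ (1 - s)) *
        (Metric.closedBall (y i) (r i + l)).indicator (fun _ => ENNReal.ofReal (r i ^ s)) z := by
    intro i
    by_cases hne : (I ∩ {α | l' ≤ r i ∧ α ∈ Metric.closedBall (y i) (r i + l')}).Nonempty
    · obtain ⟨α, h1, h2, h3⟩ := hne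
      have hmem := ball_near hll h1 h3
      have hle : ENNReal.ofReal (r i ^ s) ≤ ENNReal.ofReal (κ * l ^ s) := by
        refine le_trans ?_ hz
        have := ENNReal.le_tsum (f := fun i => (Metric.closedBall (y i) (r i + l)).indicator (fun _ => ENNReal.ofReal (r i ^ s)) z) i
        rwa [Set.indicator_of_mem hmem] at this
      rw [ENNReal.ofReal_le_ofReal_iff (by positivity)] at hle
      have hrl : r i ≤ l := by
        rw [← Real.rpow_le_rpow_iff (hr i).le hl.le hs0]
        have : 0 < l ^ s := by positivity
        nlinarith
      rw [Set.indicator_of_mem hmem, ← ENNReal.ofReal_mul (by positivity)]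
      have hv : volume (I ∩ {α | l' ≤ r i ∧ α ∈ Metric.closedBall (y i) (r i + l')}) ≤ ENNReal.ofReal (2 * (r i + l')) := by
        rw [← Real.volume_closedBall (y i)]
        exact measure_mono (fun α h => h.2.2)
      refine hv.trans (ENNReal.ofReal_le_ofReal ?_)
      have h5 : r i = r i ^ (1 - s) * r i ^ s := by
        rw [← Real.rpow_add (hr i)]; simp
      have h6 : r i ^ (1 - s) ≤ l ^ (1 - s) := Real.rpow_le_rpow (hr i).le hrl (by linarith)
      have h7 : 0 < r i ^ s := Real.rpow_pos_of_pos (hr i) s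
      nlinarith
    · rw [Set.not_nonempty_iff_eq_empty] at hne
      rw [hne]; simp
  refine (ENNReal.tsum_le_tsum hterm).trans ?_
  rw [ENNReal.tsum_mul_left]
  change ENNReal.ofReal (4 * l ^ (1 - s)) * Uf y r s l z ≤ _
  refine (mul_le_mul_right hz _).trans ?_
  rw [← ENNReal.ofReal_mul (by positivity)]
  apply ENNReal.ofReal_le_ofReal
  have h5 : l = l ^ (1 - s) * l ^ s := by
    rw [← Real.rpow_add hl]; simp
  apply le_of_eq
  calc 4 * l ^ (1 - s) * (κ * l ^ s) = 4 * κ * (l ^ (1 - s) * l ^ s) := by ring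
    _ = _ := by rw [← h5]

lemma usmall_measure (y r : ℕ → ℝ) (hr : ∀ i, 0 < r i) {s κ l l' z : ℝ}
    (hκ : 0 < κ) (hl' : 0 < l') (hll : l' ≤ l / 2)
    (hz : Uf y r s l z ≤ ENNReal.ofReal (κ * l ^ s)) :
    volume (Metric.closedBall z (l / 2) ∩ {α | ENNReal.ofReal (κ * l' ^ s) ≤ Vf y r s l' α})
      ≤ ENNReal.ofReal (4 * l * (l' / l) ^ (1 - s)) := by
  have hl : 0 < l := by linarith
  set I := Metric.closedBall z (l / 2) with hI
  have hmeas : ∀ i, MeasurableSet (Metric.closedBall (y i) (r i + l')) :=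
    fun i => Metric.isClosed_closedBall.measurableSet
  have hterm : ∀ i, ∫⁻ α in I, (if r i < l' then
      (Metric.closedBall (y i) (r i + l')).indicator (fun _ => ENNReal.ofReal (r i ^ s)) α else 0) ≤
      ENNReal.ofReal (4 * l') *
        (Metric.closedBall (y i) (r i + l)).indicator (fun _ => ENNReal.ofReal (r i ^ s)) z := by
    intro i
    split_ifs with hri
    · rw [lintegral_indicator (hmeas i), lintegral_const, Measure.restrict_apply_univ,
        Measure.restrict_apply (hmeas i)]
      by_cases hne : (Metric.closedBall (y i) (r i + l') ∩ I).Nonempty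
      · obtain ⟨α, h3, h1⟩ := hne
        have hmem := ball_near hll h1 h3
        rw [Set.indicator_of_mem hmem, mul_comm]
        gcongr
        refine (measure_mono Set.inter_subset_left).trans ?_
        rw [Real.volume_closedBall]
        apply ENNReal.ofReal_le_ofReal
        linarith
      · rw [Set.not_nonempty_iff_eq_empty] at hne
        rw [hne]; simp
    · simp
  have hIntegral : ∫⁻ α in I, Vf y r s l' α ≤ ENNReal.ofReal (4 * l' * (κ * l ^ s)) := by
    unfold Vf
    rw [lintegral_tsum]
    · refine (ENNReal.tsum_le_tsum hterm).trans ?_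
      rw [ENNReal.tsum_mul_left, ENNReal.ofReal_mul (p := 4 * l') (by positivity)]
      exact mul_le_mul_right hz _
    · intro i
      split_ifs
      · exact (measurable_const.indicator (hmeas i)).aemeasurable
      · exact aemeasurable_const
  have hpos : 0 < κ * l' ^ s := by positivity
  have hm := meas_ge_le_lintegral_div (μ := volume.restrict I)
    (measurable_Vf y r s l').aemeasurable
    (ε := ENNReal.ofReal (κ * l' ^ s)) (by simpa using hpos) ENNReal.ofReal_ne_top
  rw [Measure.restrict_apply (measurableSet_le measurable_const (measurable_Vf _ _ _ _)), Set.inter_comm] at hm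
  refine hm.trans ((ENNReal.div_le_div_right hIntegral _).trans ?_)
  rw [← ENNReal.ofReal_div_of_pos hpos]
  apply ENNReal.ofReal_le_ofReal
  apply le_of_eq
  rw [Real.div_rpow hl'.le hl.le, Real.rpow_sub hl, Real.rpow_sub hl', Real.rpow_one, Real.rpow_one]
  have : 0 < l ^ s := by positivity
  have : 0 < l' ^ s := by positivity
  field_simp

lemma Uf_eq_Vf (y r : ℕ → ℝ) {s l α : ℝ}
    (h : ¬ ∃ i, l ≤ r i ∧ α ∈ Metric.closedBall (y i) (r i + l)) : Uf y r s l α = Vf y r s l α := by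
  unfold Uf Vf
  congr 1
  ext i
  split_ifs with hi
  · rfl
  · push Not at h hi
    rw [Set.indicator_of_notMem (h i hi)]

/-- the constant `κ` -/
noncomputable def kap (p : ℕ) : ℝ := c1 p / 16000

/-- the constant `c` -/
noncomputable def cc (p : ℕ) : ℝ := kap p * c1 p / (16 * 144000 * p)

lemma kap_pos {p : ℕ} (hp : p.Prime) : 0 < kap p := by
  have := c1_pos hp; unfold kap; positivity

lemma kap_le {p : ℕ} (hp : p.Prime) : kap p ≤ 1 / 2 := by
  have := c1_le_one hp; unfold kap; linarith

lemma cc_pos {p : ℕ} (hp : p.Prime) : 0 < cc p := by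
  have := c1_pos hp; have := kap_pos hp
  have : (0 : ℝ) < p := by exact_mod_cast hp.pos
  unfold cc; positivity

lemma cc_le {p : ℕ} (hp : p.Prime) : cc p ≤ 1 / 32 := by
  have h1 := c1_le_one hp; have h2 := kap_le hp
  have h3 := c1_pos hp; have h4 := kap_pos hp
  have : (1 : ℝ) ≤ p := by exact_mod_cast hp.one_lt.le
  unfold cc
  rw [div_le_div_iff₀ (by positivity) (by norm_num)]
  nlinarith

lemma ell_half {p K : ℕ} (hp : p.Prime) (hK : 1 ≤ K) : ell p (5 * K) ≤ ell p K / 2 := by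
  have hp0 : (0 : ℝ) < p := by exact_mod_cast hp.pos
  have hp1 : (2 : ℝ) ≤ p := by exact_mod_cast hp.two_le
  unfold ell
  rw [div_div, div_le_div_iff_of_pos_left (by norm_num) (by positivity) (by positivity)]
  rw [show 5 * K = K + 4 * K by ring, pow_add]
  gcongr
  calc (2 : ℝ) ≤ p := hp1
    _ ≤ p ^ (4 * K) := le_self_pow₀ (by linarith) (by omega)

lemma zone_sub {p K : ℕ} (hp : p.Prime) (hK : 4 ≤ K) {z : ℝ} (hz : 0 ≤ z) :
    zone p K ⌊p ^ K * z⌋₊ ⊆ Metric.closedBall z (ell p K / 2) := by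
  have hp0 : (0 : ℝ) < p := by exact_mod_cast hp.pos
  have hp1 : (1 : ℝ) ≤ p := by exact_mod_cast hp.one_lt.le
  have hc0 := c1_pos hp
  have hc1 := c1_le_one hp
  have hK0 : (1 : ℝ) ≤ K := by exact_mod_cast (by omega : 1 ≤ K)
  rintro α ⟨k, m, a, hk1, hkK, hm1, hmK, hpm, ha1, ha2, hα⟩
  set b := ⌊(p : ℝ) ^ K * z⌋₊ with hb
  have hm : (1 : ℝ) ≤ m := by exact_mod_cast hm1
  have hb1 : (b : ℝ) ≤ p ^ K * z := Nat.floor_le (by positivity)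
  have hb2 : (p : ℝ) ^ K * z < b + 1 := Nat.lt_floor_add_one _
  have ha1' : (b : ℝ) * (p ^ k * m) ≤ a := by exact_mod_cast ha1
  have ha2' : (a : ℝ) < (b + 1) * (p ^ k * m) := by exact_mod_cast ha2
  have hQ : 0 < (p : ℝ) ^ k * m := by positivity
  have hP : 0 < (p : ℝ) ^ K := by positivity
  have hQ1 : 1 ≤ (p : ℝ) ^ k * m := by
    have : 1 ≤ (p : ℝ) ^ k := one_le_pow₀ hp1
    nlinarith
  rw [Metric.mem_closedBall, Real.dist_eq]
  have hx : |(a : ℝ) / (p ^ K * (p ^ k * m)) - z| ≤ 1 / p ^ K := by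
    have h1 : (a : ℝ) / (p ^ K * (p ^ k * m)) = (a / (p ^ k * m)) / p ^ K := by field_simp
    have h2 : (b : ℝ) ≤ a / (p ^ k * m) := by rwa [le_div_iff₀ hQ]
    have h3 : (a : ℝ) / (p ^ k * m) ≤ b + 1 := by rw [div_le_iff₀ hQ]; exact ha2'.le
    have h4 : z = (p ^ K * z) / p ^ K := by field_simp
    rw [h1]
    conv_lhs => rw [h4]
    rw [← sub_div, abs_div, abs_of_pos hP]
    gcongr
    rw [abs_le]; constructor <;> linarith
  have hr : c1 p / (p ^ K * (p ^ k * m) * m * (K : ℝ) ^ 2) ≤ 1 / p ^ K := by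
    apply div_le_div₀ (by norm_num) hc1 hP
    have : 1 ≤ (p ^ k * m) * m * (K : ℝ) ^ 2 := by
      have h5 : 1 ≤ (K : ℝ) ^ 2 := one_le_pow₀ hK0
      have h6 : 1 ≤ (p : ℝ) ^ k * m * m := one_le_mul_of_one_le_of_one_le hQ1 hm
      exact one_le_mul_of_one_le_of_one_le h6 h5
    calc (p : ℝ) ^ K = p ^ K * 1 := by ring
      _ ≤ p ^ K * ((p ^ k * m) * m * (K : ℝ) ^ 2) := by gcongr
      _ = _ := by ring
  calc |α - z| ≤ |α - (a : ℝ) / (p ^ K * (p ^ k * m))| + |(a : ℝ) / (p ^ K * (p ^ k * m)) - z| := abs_sub_le _ _ _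
    _ ≤ 1 / p ^ K + 1 / p ^ K := by gcongr; exact hα.trans hr
    _ = 2 / p ^ K := by ring
    _ ≤ ell p K / 2 := by
      unfold ell
      rw [div_div, div_le_div_iff₀ hP (by positivity)]
      nlinarith

lemma step {p K K' : ℕ} (hp : p.Prime) (hK : 4 ≤ K) (hK' : 1 ≤ K') (hKK : K' ≤ K)
    (C : Finset (ℕ × ℕ)) (hC : ∀ e ∈ C, 256 * hgt p e ≤ p ^ K)
    (hlarge : (K : ℝ) ^ 2 ≤ 32 * cc p * p ^ (4 * K))
    (y r : ℕ → ℝ) (hr : ∀ i, 0 < r i) {s : ℝ} (hs0 : 0 < s) (hs1 : s < 1)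
    (hsmall : 32 * (1 / (p : ℝ) ^ (4 * K)) ^ (1 - s) ≤ c1 p / 64)
    (z : ℝ) (hz0 : ell p K ≤ z)
    (hzW : Wf p (cc p) K' C (ell p K) z < ENNReal.ofReal (kap p))
    (hzU : Uf y r s (ell p K) z ≤ ENNReal.ofReal (kap p * ell p K ^ s)) :
    ∃ α : ℝ, |α - z| ≤ ell p K / 2 ∧ ell p (5 * K) ≤ α ∧
      Wf p (cc p) K (cls p K) (ell p (5 * K)) α < ENNReal.ofReal (kap p) ∧
      Uf y r s (ell p (5 * K)) α ≤ ENNReal.ofReal (kap p * ell p (5 * K) ^ s) ∧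
      (∃ b, α ∈ zone p K b) ∧
      (∀ e ∈ C, α ∉ nearS (clsS p e) (rho p (cc p) K' e + ell p (5 * K))) ∧
      (∀ i, ell p (5 * K) ≤ r i → α ∉ Metric.closedBall (y i) (r i + ell p (5 * K))) := by
  have hp0 : (0 : ℝ) < p := by exact_mod_cast hp.pos
  have hl := ell_pos hp K
  have hl' := ell_pos hp (5 * K)
  have hll := ell_half hp (by omega : 1 ≤ K)
  have hκ := kap_pos hp
  have hκ2 := kap_le hp
  have hc := cc_pos hp
  have hc1 := c1_pos hp
  have m1 := zone_measure p K ⌊p ^ K * z⌋₊ hp hK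
  have m2 := old_measure hp hK' hKK hc (cc_le hp) hκ hκ2 C hC hlarge z hzW
  have m3 := new_measure hp (by omega : 1 ≤ K) hc (cc_le hp) hκ z
  have m4 := ubig_measure y r hr hs0 hs1 hκ (by linarith) hl' hll hzU
  have m5 := usmall_measure y r hr hκ hl' hll hzU
  set I := Metric.closedBall z (ell p K / 2) with hI
  set E1 := I ∩ {α | ∃ e ∈ C, α ∈ nearS (clsS p e) (rho p (cc p) K' e + ell p (5 * K))} with hE1
  set E2 := I ∩ {α | ENNReal.ofReal (kap p) ≤ Wf p (cc p) K (cls p K) (ell p (5 * K)) α} with hE2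
  set E3 := I ∩ {α | ∃ i, ell p (5 * K) ≤ r i ∧ α ∈ Metric.closedBall (y i) (r i + ell p (5 * K))} with hE3
  set E4 := I ∩ {α | ENNReal.ofReal (kap p * ell p (5 * K) ^ s) ≤ Vf y r s (ell p (5 * K)) α} with hE4
  have hP : 0 < (p : ℝ) ^ K := by positivity
  have hex : ∃ α ∈ zone p K ⌊p ^ K * z⌋₊, α ∉ E1 ∪ E2 ∪ (E3 ∪ E4) := by
    by_contra hcon
    push Not at hcon
    have hsub : zone p K ⌊p ^ K * z⌋₊ ⊆ E1 ∪ E2 ∪ (E3 ∪ E4) := hcon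
    have h1 : ENNReal.ofReal (c1 p / 16 / p ^ K) ≤ ENNReal.ofReal (128 * kap p / p ^ K) +
        ENNReal.ofReal (36000 * p * cc p / kap p / p ^ K) + (ENNReal.ofReal (4 * kap p * ell p K) +
        ENNReal.ofReal (4 * ell p K * (ell p (5 * K) / ell p K) ^ (1 - s))) := by
      refine m1.trans ((measure_mono hsub).trans ((measure_union_le _ _).trans ?_))
      exact add_le_add ((measure_union_le _ _).trans (add_le_add m2 m3))
        ((measure_union_le _ _).trans (add_le_add m4 m5))
    rw [← ENNReal.ofReal_add (by positivity) (by positivity), ← ENNReal.ofReal_add (by positivity) (by positivity),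
      ← ENNReal.ofReal_add (by positivity) (by positivity), ENNReal.ofReal_le_ofReal_iff (by positivity)] at h1
    have h2 : ell p (5 * K) / ell p K = 1 / (p : ℝ) ^ (4 * K) := by
      unfold ell
      rw [show 5 * K = K + 4 * K by ring, pow_add]
      field_simp
    rw [h2] at h1
    have h3 : 36000 * p * cc p / kap p = c1 p / 64 := by
      unfold cc; field_simp; norm_num
    rw [h3] at h1
    have h4 : 4 * ell p K * (1 / (p : ℝ) ^ (4 * K)) ^ (1 - s) = (32 * (1 / (p : ℝ) ^ (4 * K)) ^ (1 - s)) / p ^ K := by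
      unfold ell; ring
    have h5 : 4 * kap p * ell p K = 32 * kap p / p ^ K := by unfold ell; ring
    rw [h4, h5, ← add_div, ← add_div, ← add_div, div_le_div_iff_of_pos_right hP] at h1
    unfold kap at h1
    linarith
  obtain ⟨α, hα, hnot⟩ := hex
  have hαI := zone_sub hp hK (by linarith) hα
  simp only [Set.mem_union, not_or, E1, E2, E3, E4, Set.mem_inter_iff, not_and, Set.mem_ofPred_eq] at hnot
  obtain ⟨⟨n1, n2⟩, n3, n4⟩ := hnot
  replace n1 := n1 hαI
  replace n2 := n2 hαI
  replace n3 := n3 hαI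
  replace n4 := n4 hαI
  have hαz : |α - z| ≤ ell p K / 2 := by
    have := hαI; rwa [Metric.mem_closedBall, Real.dist_eq] at this
  refine ⟨α, hαz, ?_, not_le.mp n2, ?_, ⟨_, hα⟩, ?_, ?_⟩
  · have := (abs_le.mp hαz).1
    linarith
  · rw [Uf_eq_Vf y r n3]
    exact (not_le.mp n4).le
  · intro e he h
    exact n1 ⟨e, he, h⟩
  · intro i hi h
    exact n3 ⟨i, hi, h⟩

/-- stages -/
def Kj (K0 j : ℕ) : ℕ := K0 * 5 ^ j

lemma Kj_succ (K0 j : ℕ) : Kj K0 (j + 1) = 5 * Kj K0 j := by unfold Kj; ring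

lemma Kj_ge (K0 j : ℕ) : K0 ≤ Kj K0 j := by
  unfold Kj; exact Nat.le_mul_of_pos_right _ (by positivity)

lemma Kj_ge' {K0 : ℕ} (h : 1 ≤ K0) (j : ℕ) : j ≤ Kj K0 j := by
  unfold Kj
  calc j ≤ 5 ^ j := (Nat.lt_pow_self (by norm_num)).le
    _ ≤ _ := Nat.le_mul_of_pos_left _ h

/-- previous stage -/
def Kp (K0 : ℕ) : ℕ → ℕ
  | 0 => 1
  | j + 1 => Kj K0 j

/-- old classes at step `j` -/
def Cj (p K0 : ℕ) : ℕ → Finset (ℕ × ℕ)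
  | 0 => ∅
  | j + 1 => cls p (Kj K0 j)

lemma construct {p K0 : ℕ} (hp : p.Prime) (hK0 : 4 ≤ K0)
    (hlarge : ∀ K, K0 ≤ K → (K : ℝ) ^ 2 ≤ 32 * cc p * p ^ (4 * K))
    (y r : ℕ → ℝ) (hr : ∀ i, 0 < r i) {s : ℝ} (hs0 : 0 < s) (hs1 : s < 1)
    (hsmall : ∀ K, K0 ≤ K → 32 * (1 / (p : ℝ) ^ (4 * K)) ^ (1 - s) ≤ c1 p / 64)
    (hell : ell p K0 ≤ 1 / 2)
    (hU : ∑' i, ENNReal.ofReal (r i ^ s) ≤ ENNReal.ofReal (kap p * ell p K0 ^ s)) :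
    ∃ α : ℝ, (∀ i, α ∉ Metric.closedBall (y i) (r i)) ∧
      (∀ j, ∀ e ∈ cls p (Kj K0 j), ∀ x ∈ clsS p e, rho p (cc p) (Kj K0 j) e < |x - α|) ∧
      (∀ j, ∃ b, ∃ z ∈ zone p (Kj K0 j) b, |α - z| ≤ ell p (5 * Kj K0 j)) := by
  let P : ℕ → ℝ → Prop := fun j z => ell p (Kj K0 j) ≤ z ∧
    Wf p (cc p) (Kp K0 j) (Cj p K0 j) (ell p (Kj K0 j)) z < ENNReal.ofReal (kap p) ∧
    Uf y r s (ell p (Kj K0 j)) z ≤ ENNReal.ofReal (kap p * ell p (Kj K0 j) ^ s)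
  let R : ℕ → ℝ → ℝ → Prop := fun j z α => |α - z| ≤ ell p (Kj K0 j) / 2 ∧
      (∃ b, α ∈ zone p (Kj K0 j) b) ∧
      (∀ e ∈ Cj p K0 j, α ∉ nearS (clsS p e) (rho p (cc p) (Kp K0 j) e + ell p (Kj K0 (j + 1)))) ∧
      (∀ i, ell p (Kj K0 (j + 1)) ≤ r i → α ∉ Metric.closedBall (y i) (r i + ell p (Kj K0 (j + 1))))
  have hstep : ∀ j z, ∃ α, P j z → P (j + 1) α ∧ R j z α := by
    intro j z
    by_cases hP : P j z
    · obtain ⟨h1, h2, h3⟩ := hP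
      have hKpos : 1 ≤ Kp K0 j := by
        cases j with
        | zero => exact le_rfl
        | succ j => exact le_trans (by omega) (Kj_ge K0 j)
      have hKle : Kp K0 j ≤ Kj K0 j := by
        cases j with
        | zero => exact le_trans (by simp [Kp]; omega) (Kj_ge K0 0)
        | succ j => rw [Kj_succ]; simp only [Kp]; omega
      have hC : ∀ e ∈ Cj p K0 j, 256 * hgt p e ≤ p ^ (Kj K0 j) := by
        cases j with
        | zero => intro e he; simp [Cj] at he
        | succ j =>
          intro e he
          rw [Kj_succ]
          exact ((mem_cls hp).mp he).2
      obtain ⟨α, a1, a2, a3, a4, a5, a6, a7⟩ := step hp (hK0.trans (Kj_ge K0 j)) hKpos hKle (Cj p K0 j) hC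
        (hlarge _ (Kj_ge K0 j)) y r hr hs0 hs1 (hsmall _ (Kj_ge K0 j)) z h1 h2 h3
      rw [← Kj_succ] at a2 a3 a4 a6 a7
      exact ⟨α, fun _ => ⟨⟨a2, a3, a4⟩, a1, a5, a6, a7⟩⟩
    · exact ⟨0, fun h => absurd h hP⟩
  choose g hg using hstep
  let z : ℕ → ℝ := fun n => Nat.rec (1 / 2) (fun j w => g j w) n
  have hz : ∀ j, P j (z j) := by
    intro j
    induction j with
    | zero =>
      have hK : Kj K0 0 = K0 := by simp [Kj]
      refine ⟨by rw [hK]; exact hell, ?_, ?_⟩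
      · simp only [Wf, Cj, Finset.sum_empty]
        simpa using kap_pos hp
      · rw [hK]
        refine le_trans ?_ hU
        unfold Uf
        apply ENNReal.tsum_le_tsum
        intro i
        exact Set.indicator_le_self' (fun _ _ => zero_le) _
    | succ j ih => exact (hg j (z j) ih).1
  have hR : ∀ j, R j (z j) (z (j + 1)) := fun j => (hg j (z j) (hz j)).2
  let B : ℕ → Set ℝ := fun j => Metric.closedBall (z j) (ell p (Kj K0 j))
  have hne : (⋂ j, B j).Nonempty := by
    apply IsCompact.nonempty_iInter_of_sequence_nonempty_isCompact_isClosed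
    · intro j
      apply Metric.closedBall_subset_closedBall'
      have h1 := (hR j).1
      have h2 := ell_half hp (le_trans (by omega) (Kj_ge K0 j) : 1 ≤ Kj K0 j)
      rw [← Kj_succ] at h2
      rw [Real.dist_eq]
      linarith
    · intro j
      exact Metric.nonempty_closedBall.mpr (ell_pos hp _).le
    · exact isCompact_closedBall _ _
    · intro j; exact Metric.isClosed_closedBall
  obtain ⟨α, hα⟩ := hne
  have hαj : ∀ j, |α - z j| ≤ ell p (Kj K0 j) := by
    intro j
    have := Set.mem_iInter.mp hα j
    rwa [Metric.mem_closedBall, Real.dist_eq] at this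
  refine ⟨α, ?_, ?_, ?_⟩
  · intro i hi
    have hp1 : (1 : ℝ) < p := by exact_mod_cast hp.one_lt
    obtain ⟨n, hn⟩ := pow_unbounded_of_one_lt (8 / r i) hp1
    have hle : ell p (Kj K0 (n + 1)) ≤ r i := by
      have h1 : (p : ℝ) ^ n ≤ p ^ (Kj K0 (n + 1)) :=
        pow_le_pow_right₀ hp1.le (by have := Kj_ge' (by omega : 1 ≤ K0) (n + 1); omega)
      have hri := hr i
      unfold ell
      rw [div_lt_iff₀ hri] at hn
      rw [div_le_iff₀ (by positivity)]
      nlinarith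
    apply (hR n).2.2.2 i hle
    rw [Metric.mem_closedBall] at *
    have h3 := hαj (n + 1)
    have := dist_triangle (z (n + 1)) α (y i)
    rw [← Real.dist_eq, dist_comm] at h3
    linarith
  · intro j e he x hx
    by_contra hcon
    push Not at hcon
    apply (hR (j + 1)).2.2.1 e he
    refine ⟨x, hx, ?_⟩
    have h3 := hαj (j + 2)
    calc |x - z (j + 1 + 1)| ≤ |x - α| + |α - z (j + 2)| := abs_sub_le _ _ _
      _ ≤ _ := add_le_add hcon h3
  · intro j
    obtain ⟨b, hb⟩ := (hR j).2.1
    refine ⟨b, z (j + 1), hb, ?_⟩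
    rw [← Kj_succ]
    exact hαj (j + 1)

lemma lower {p K0 : ℕ} (hp : p.Prime) (hK0 : 4 ≤ K0) {α : ℝ}
    (hB : ∀ j, ∀ e ∈ cls p (Kj K0 j), ∀ x ∈ clsS p e, rho p (cc p) (Kj K0 j) e < |x - α|)
    {q : ℕ} (hq : 256 ≤ q) (hq' : p ^ K0 ≤ q) :
    cc p * (Real.log p) ^ 2 / 9 ≤ (q : ℝ) * (Real.log q) ^ 2 * nint (q * α) * pabs p q := by
  have : Fact p.Prime := ⟨hp⟩
  have hp0 : (0 : ℝ) < p := by exact_mod_cast hp.pos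
  have hp1 : (1 : ℝ) < p := by exact_mod_cast hp.one_lt
  have hlp : 0 < Real.log p := Real.log_pos hp1
  have hc := cc_pos hp
  set k := padicValNat p q with hk
  obtain ⟨m, hm⟩ : p ^ k ∣ q := pow_padicValNat_dvd
  have hm0 : m ≠ 0 := by rintro rfl; simp at hm; omega
  set i := Nat.log 2 m with hi
  have hi1 : 2 ^ i ≤ m := Nat.pow_log_le_self 2 hm0
  have hi2 : m < 2 ^ (i + 1) := Nat.lt_pow_succ_log_self (by norm_num) m
  set e : ℕ × ℕ := (k, i) with he
  have hpk : 0 < p ^ k := pow_pos hp.pos k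
  have h42 : 4 ^ i = 2 ^ i * 2 ^ i := by rw [← mul_pow]; norm_num
  have hh1 : p ^ K0 < 256 * hgt p e := by
    refine lt_of_le_of_lt hq' ?_
    unfold hgt
    simp only [he]
    have h2 : 0 < 2 ^ i := by positivity
    have h3 : 2 ^ i ≤ 4 ^ i := Nat.pow_le_pow_left (by norm_num) _
    rw [pow_succ] at hi2
    calc q = p ^ k * m := hm
      _ < p ^ k * (256 * 4 ^ i) := by
        apply Nat.mul_lt_mul_of_pos_left _ hpk
        omega
      _ = _ := by ring
  have hh2 : hgt p e ≤ q * q := by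
    unfold hgt
    simp only [he]
    calc p ^ k * 4 ^ i ≤ p ^ k * (m * m) := by
          rw [h42]; exact Nat.mul_le_mul_left _ (Nat.mul_le_mul hi1 hi1)
      _ ≤ (p ^ k * p ^ k) * (m * m) := Nat.mul_le_mul_right _ (Nat.le_mul_of_pos_left _ hpk)
      _ = q * q := by rw [hm]; ring
  have hexj : ∃ j, 256 * hgt p e ≤ p ^ (Kj K0 j) := by
    refine ⟨256 * hgt p e, ?_⟩
    calc 256 * hgt p e ≤ p ^ (256 * hgt p e) := (Nat.lt_pow_self hp.one_lt).le
      _ ≤ _ := Nat.pow_le_pow_right hp.pos (Kj_ge' (by omega) _)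
  obtain ⟨j, hj1, hj2⟩ : ∃ j, p ^ (Kj K0 j) < 256 * hgt p e ∧ 256 * hgt p e ≤ p ^ (Kj K0 (j + 1)) := by
    classical
    have h1 := Nat.find_spec hexj
    have h2 : Nat.find hexj ≠ 0 := by
      intro h
      rw [h] at h1
      simp only [Kj, pow_zero, mul_one] at h1
      omega
    obtain ⟨j, hj⟩ := Nat.exists_eq_succ_of_ne_zero h2
    refine ⟨j, ?_, ?_⟩
    · have := Nat.find_min hexj (m := j) (by omega)
      omega
    · rw [hj] at h1; exact h1
  rw [Kj_succ] at hj2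
  have hx := hB j e ((mem_cls hp).mpr ⟨hj1, hj2⟩) ((round ((q : ℝ) * α) : ℤ) / ((p : ℝ) ^ k * m))
    ⟨_, m, hi1, hi2, rfl⟩
  set K := Kj K0 j with hK
  have hKpos : (0 : ℝ) < K := by
    have := Kj_ge K0 j
    exact_mod_cast (by omega : 0 < K)
  have hqR : (q : ℝ) = p ^ k * m := by rw [hm]; push_cast; rfl
  have hmR : (0 : ℝ) < m := by exact_mod_cast Nat.pos_of_ne_zero hm0
  have hq0 : (0 : ℝ) < q := by rw [hqR]; positivity
  rw [← hqR] at hx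
  have hnint : nint (q * α) = q * |(round ((q : ℝ) * α) : ℤ) / (q : ℝ) - α| := by
    unfold nint
    rw [← abs_of_pos hq0, ← abs_mul, abs_of_pos hq0, abs_sub_comm]
    congr 1
    field_simp
  have hpabs : pabs p q = 1 / p ^ k := by
    unfold pabs
    rw [zpow_neg, zpow_natCast, ← hk, one_div]
  have hlogq : K * Real.log p ≤ 3 * Real.log q := by
    have h1 : (p : ℝ) ^ K ≤ (q : ℝ) ^ 3 := by
      have : p ^ K ≤ q ^ 3 := by
        calc p ^ K ≤ 256 * hgt p e := hj1.le
          _ ≤ q * (q * q) := Nat.mul_le_mul hq hh2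
          _ = _ := by ring
      exact_mod_cast this
    have h2 := Real.log_le_log (by positivity) h1
    rw [Real.log_pow, Real.log_pow] at h2
    exact_mod_cast h2
  have hgR : (hgt p e : ℝ) ≤ p ^ k * m ^ 2 := by
    have : hgt p e ≤ p ^ k * m ^ 2 := by
      unfold hgt; simp only [he]
      rw [h42, sq]; exact Nat.mul_le_mul_left _ (Nat.mul_le_mul hi1 hi1)
    exact_mod_cast this
  have hg0 : (0 : ℝ) < hgt p e := by exact_mod_cast hgt_pos hp e
  rw [hnint, hpabs]
  have hrho : cc p / (p ^ k * m ^ 2 * (K : ℝ) ^ 2) ≤ |(round ((q : ℝ) * α) : ℤ) / (q : ℝ) - α| := by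
    refine le_trans ?_ hx.le
    unfold rho
    gcongr
  have hl1 : (K * Real.log p) ^ 2 ≤ (3 * Real.log q) ^ 2 := by
    gcongr
  calc cc p * (Real.log p) ^ 2 / 9 = cc p * (K * Real.log p) ^ 2 / (9 * (K : ℝ) ^ 2) := by field_simp
    _ ≤ cc p * (3 * Real.log q) ^ 2 / (9 * (K : ℝ) ^ 2) := by gcongr
    _ = q * (Real.log q) ^ 2 * (q * (cc p / (p ^ k * m ^ 2 * (K : ℝ) ^ 2))) * (1 / p ^ k) := by
        have hpk' : (0 : ℝ) < (p : ℝ) ^ k := by positivity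
        rw [hqR]
        field_simp
        ring
    _ ≤ _ := by gcongr

lemma upper {p K : ℕ} (hp : p.Prime) (hK : 4 ≤ K) {α z : ℝ} {b : ℕ} (hz : z ∈ zone p K b)
    (hαz : |α - z| ≤ ell p (5 * K)) (hlarge : 8 * (K : ℝ) ^ 2 ≤ c1 p * p ^ K) :
    ∃ q : ℕ, K ≤ q ∧ (q : ℝ) * (Real.log q) ^ 2 * nint (q * α) * pabs p q ≤ 18 * c1 p * (Real.log p) ^ 2 := by
  have : Fact p.Prime := ⟨hp⟩
  have hp0 : (0 : ℝ) < p := by exact_mod_cast hp.pos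
  have hp1 : (1 : ℝ) < p := by exact_mod_cast hp.one_lt
  have hc1 := c1_pos hp
  have hK0 : (0 : ℝ) < K := by exact_mod_cast (by omega : 0 < K)
  obtain ⟨k, m, a, hk1, hkK, hm1, hmK, hpm, ha1, ha2, hza⟩ := hz
  have hm0 : (0 : ℝ) < m := by exact_mod_cast hm1
  have hmK' : (m : ℝ) ≤ p ^ K := by exact_mod_cast hmK
  have hkK' : (p : ℝ) ^ k ≤ p ^ K := pow_le_pow_right₀ hp1.le hkK
  set q := p ^ K * (p ^ k * m) with hq
  have hqR : (q : ℝ) = p ^ K * (p ^ k * m) := by rw [hq]; push_cast; rfl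
  have hq0 : (0 : ℝ) < q := by rw [hqR]; positivity
  have hval : padicValNat p q = K + k := by
    rw [hq, ← mul_assoc, ← pow_add, padicValNat.mul (pow_pos hp.pos _).ne' (by omega),
      padicValNat.prime_pow, padicValNat.eq_zero_of_not_dvd hpm, add_zero]
  have hqge : p ^ K ≤ q := Nat.le_mul_of_pos_right _ (Nat.mul_pos (pow_pos hp.pos _) hm1)
  refine ⟨q, (Nat.lt_pow_self hp.one_lt).le.trans hqge, ?_⟩
  have hpabs : pabs p q = 1 / (p ^ K * p ^ k) := by
    unfold pabs
    rw [zpow_neg, zpow_natCast, hval, one_div, pow_add]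
  rw [← hqR] at hza
  have hsmall : ell p (5 * K) ≤ c1 p / (q * m * (K : ℝ) ^ 2) := by
    unfold ell
    rw [div_le_div_iff₀ (by positivity) (by positivity)]
    calc 8 * (q * m * (K : ℝ) ^ 2) = (8 * (K : ℝ) ^ 2) * (p ^ K * (p ^ k * m) * m) := by rw [hqR]; ring
      _ ≤ (c1 p * p ^ K) * (p ^ K * (p ^ K * p ^ K) * p ^ K) := by gcongr
      _ = _ := by ring
  have hnint : nint (q * α) ≤ 2 * c1 p / (m * (K : ℝ) ^ 2) := by
    unfold nint
    have h1 := round_le ((q : ℝ) * α) (a : ℤ)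
    refine h1.trans ?_
    have h2 : (q : ℝ) * α - ((a : ℤ) : ℝ) = q * (α - a / q) := by
      push_cast; field_simp
    rw [h2, abs_mul, abs_of_pos hq0]
    calc (q : ℝ) * |α - a / q| ≤ q * (|α - z| + |z - a / q|) := by gcongr; exact abs_sub_le _ _ _
      _ ≤ q * (c1 p / (q * m * (K : ℝ) ^ 2) + c1 p / (q * m * (K : ℝ) ^ 2)) := by
        gcongr; exact hαz.trans hsmall
      _ = _ := by field_simp; ring
  have hlog : Real.log q ≤ 3 * K * Real.log p := by
    have h1 : (q : ℝ) ≤ p ^ (3 * K) := by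
      rw [hqR]
      calc (p : ℝ) ^ K * (p ^ k * m) ≤ p ^ K * (p ^ K * p ^ K) := by gcongr
        _ = _ := by ring
    have h2 := Real.log_le_log hq0 h1
    rw [Real.log_pow] at h2
    exact_mod_cast h2
  have hlog0 : 0 ≤ Real.log q := Real.log_natCast_nonneg q
  rw [hpabs]
  have hnn : 0 ≤ nint (q * α) := abs_nonneg _
  calc (q : ℝ) * (Real.log q) ^ 2 * nint (q * α) * (1 / (p ^ K * p ^ k))
      ≤ q * (3 * K * Real.log p) ^ 2 * (2 * c1 p / (m * (K : ℝ) ^ 2)) * (1 / (p ^ K * p ^ k)) := by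
        gcongr
    _ = _ := by
      rw [hqR]
      field_simp
      ring

lemma liminf_pos {p K0 : ℕ} (hp : p.Prime) (hK0 : 4 ≤ K0) {α : ℝ}
    (hlarge : ∀ K : ℕ, K0 ≤ K → 8 * (K : ℝ) ^ 2 ≤ c1 p * p ^ K)
    (hB : ∀ j, ∀ e ∈ cls p (Kj K0 j), ∀ x ∈ clsS p e, rho p (cc p) (Kj K0 j) e < |x - α|)
    (hZ : ∀ j, ∃ b, ∃ z ∈ zone p (Kj K0 j) b, |α - z| ≤ ell p (5 * Kj K0 j)) :
    0 < atTop.liminf (fun q : ℕ =>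
        (q : ℝ) * (Real.log q) ^ 2 * nint (q * α) * pabs p q) := by
  have hp1 : (1 : ℝ) < p := by exact_mod_cast hp.one_lt
  have hlp : 0 < Real.log p := Real.log_pos hp1
  have hc := cc_pos hp
  have hpos : 0 < cc p * (Real.log p) ^ 2 / 9 := by positivity
  refine lt_of_lt_of_le hpos ?_
  apply le_liminf_of_le
  · apply Filter.IsCoboundedUnder.of_frequently_le (a := 18 * c1 p * (Real.log p) ^ 2)
    rw [frequently_atTop]
    intro N
    obtain ⟨b, z, hz, hαz⟩ := hZ N
    obtain ⟨q, hq1, hq2⟩ := upper hp (hK0.trans (Kj_ge K0 N)) hz hαz (hlarge _ (Kj_ge K0 N))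
    exact ⟨q, (Kj_ge' (by omega) N).trans hq1, hq2⟩
  · filter_upwards [eventually_ge_atTop 256, eventually_ge_atTop (p ^ K0)] with q h1 h2
    exact lower hp hK0 hB h1 h2

lemma exists_K0 {p : ℕ} (hp : p.Prime) {s : ℝ} (hs1 : s < 1) :
    ∃ K0 : ℕ, 4 ≤ K0 ∧ (∀ K : ℕ, K0 ≤ K → (K : ℝ) ^ 2 ≤ 32 * cc p * p ^ (4 * K)) ∧
      (∀ K : ℕ, K0 ≤ K → 8 * (K : ℝ) ^ 2 ≤ c1 p * p ^ K) ∧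
      (∀ K : ℕ, K0 ≤ K → 32 * (1 / (p : ℝ) ^ (4 * K)) ^ (1 - s) ≤ c1 p / 64) ∧
      ell p K0 ≤ 1 / 2 := by
  have hp1 : (1 : ℝ) < p := by exact_mod_cast hp.one_lt
  have hp0 : (0 : ℝ) < p := by linarith
  have hp2 : (2 : ℝ) ≤ p := by exact_mod_cast hp.two_le
  have hc := cc_pos hp
  have hc1 := c1_pos hp
  have ht := tendsto_pow_const_div_const_pow_of_one_lt 2 hp1
  have e1 : ∀ᶠ K : ℕ in atTop, (K : ℝ) ^ 2 / p ^ K < 32 * cc p :=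
    ht.eventually (gt_mem_nhds (by positivity))
  have e2 : ∀ᶠ K : ℕ in atTop, (K : ℝ) ^ 2 / p ^ K < c1 p / 8 :=
    ht.eventually (gt_mem_nhds (by positivity))
  have hinv : Tendsto (fun K : ℕ => 1 / (p : ℝ) ^ (4 * K)) atTop (nhds 0) := by
    have h1 : Tendsto (fun K : ℕ => (1 / (p : ℝ) ^ 4) ^ K) atTop (nhds 0) := by
      apply tendsto_pow_atTop_nhds_zero_of_lt_one (by positivity)
      rw [div_lt_one (by positivity)]
      exact one_lt_pow₀ hp1 (by norm_num)
    refine h1.congr (fun K => ?_)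
    rw [div_pow, one_pow, pow_mul]
  have h3 : Tendsto (fun K : ℕ => (1 / (p : ℝ) ^ (4 * K)) ^ (1 - s)) atTop (nhds 0) := by
    have := hinv.rpow_const (p := 1 - s) (Or.inr (by linarith))
    rwa [Real.zero_rpow (by linarith)] at this
  have e3 : ∀ᶠ K : ℕ in atTop, (1 / (p : ℝ) ^ (4 * K)) ^ (1 - s) < c1 p / 2048 :=
    h3.eventually (gt_mem_nhds (by positivity))
  obtain ⟨N, hN⟩ := eventually_atTop.mp (e1.and (e2.and e3))
  refine ⟨max N 4, le_max_right _ _, ?_, ?_, ?_, ?_⟩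
  · intro K hK
    have h := (hN K (le_trans (le_max_left _ _) hK)).1
    rw [div_lt_iff₀ (by positivity)] at h
    refine h.le.trans ?_
    gcongr
    · exact hp1.le
    · omega
  · intro K hK
    have h := (hN K (le_trans (le_max_left _ _) hK)).2.1
    rw [div_lt_iff₀ (by positivity)] at h
    linarith
  · intro K hK
    have h := (hN K (le_trans (le_max_left _ _) hK)).2.2
    linarith
  · unfold ell
    rw [div_le_div_iff₀ (by positivity) (by norm_num)]
    have : (2 : ℝ) ^ 4 ≤ p ^ (max N 4) := by
      calc (2 : ℝ) ^ 4 ≤ p ^ 4 := by gcongr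
        _ ≤ _ := pow_le_pow_right₀ hp1.le (le_max_right _ _)
    linarith

lemma exists_cover {S : Set ℝ} {s : ℝ} (hs0 : 0 < s) (hS : Measure.hausdorffMeasure s S = 0) {ε : ℝ} (hε : 0 < ε) :
    ∃ y r : ℕ → ℝ, (∀ i, 0 < r i) ∧ (∑' i, ENNReal.ofReal (r i ^ s) ≤ ENNReal.ofReal ε) ∧
      ∀ α ∈ S, ∃ i, α ∈ Metric.closedBall (y i) (r i) := by
  classical
  rw [Measure.hausdorffMeasure_apply] at hS
  have h1 : (⨅ (t : ℕ → Set ℝ) (_ : S ⊆ ⋃ n, t n) (_ : ∀ n, Metric.ediam (t n) ≤ 1),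
      ∑' n, ⨆ _ : (t n).Nonempty, Metric.ediam (t n) ^ s) < ENNReal.ofReal (ε / 2) := by
    refine lt_of_le_of_lt ?_ (show (0 : ENNReal) < ENNReal.ofReal (ε / 2) by simpa using hε)
    rw [← hS]
    exact le_iSup₂ (f := fun (r : ENNReal) (_ : 0 < r) => ⨅ (t : ℕ → Set ℝ) (_ : S ⊆ ⋃ n, t n) (_ : ∀ n, Metric.ediam (t n) ≤ r),
      ∑' n, ⨆ _ : (t n).Nonempty, Metric.ediam (t n) ^ s) 1 one_pos
  simp only [iInf_lt_iff] at h1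
  obtain ⟨t, hcov, hd, hsum⟩ := h1
  obtain ⟨δ, hδ0, hδ⟩ := ENNReal.exists_pos_sum_of_countable' (ε := ENNReal.ofReal (ε / 2)) (by simpa using hε) ℕ
  have hδtop : ∀ i, δ i ≠ ⊤ := fun i => ne_top_of_lt ((ENNReal.le_tsum i).trans_lt hδ)
  let D : ℕ → ℝ := fun i => (Metric.ediam (t i)).toReal
  have hD0 : ∀ i, 0 ≤ D i := fun i => ENNReal.toReal_nonneg
  have hDtop : ∀ i, Metric.ediam (t i) ≠ ⊤ := fun i => ne_top_of_le_ne_top ENNReal.one_ne_top (hd i)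
  have hδR : ∀ i, 0 < (δ i).toReal := fun i => ENNReal.toReal_pos (hδ0 i).ne' (hδtop i)
  have hX : ∀ i, 0 < D i ^ s + (δ i).toReal := fun i => by
    have := Real.rpow_nonneg (hD0 i) s
    linarith [hδR i]
  let y : ℕ → ℝ := fun i => if h : (t i).Nonempty then h.some else 0
  let r : ℕ → ℝ := fun i => (D i ^ s + (δ i).toReal) ^ (1 / s)
  have hrs : ∀ i, r i ^ s = D i ^ s + (δ i).toReal := by
    intro i
    simp only [r]
    rw [← Real.rpow_mul (hX i).le, one_div_mul_cancel hs0.ne', Real.rpow_one]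
  have hr0 : ∀ i, 0 < r i := fun i => Real.rpow_pos_of_pos (hX i) _
  refine ⟨y, r, hr0, ?_, ?_⟩
  · have hterm : ∀ i, ENNReal.ofReal (r i ^ s) ≤ (⨆ _ : (t i).Nonempty, Metric.ediam (t i) ^ s) + δ i := by
      intro i
      rw [hrs, ENNReal.ofReal_add (Real.rpow_nonneg (hD0 i) s) (hδR i).le, ENNReal.ofReal_toReal (hδtop i)]
      gcongr
      by_cases hne : (t i).Nonempty
      · simp only [hne, iSup_pos, D]
        rw [← ENNReal.ofReal_rpow_of_nonneg (by positivity) hs0.le, ENNReal.ofReal_toReal (hDtop i)]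
      · rw [Set.not_nonempty_iff_eq_empty] at hne
        simp [D, hne, Real.zero_rpow hs0.ne']
    refine (ENNReal.tsum_le_tsum hterm).trans ?_
    rw [ENNReal.tsum_add]
    refine (add_le_add hsum.le hδ.le).trans ?_
    rw [← ENNReal.ofReal_add (by positivity) (by positivity), add_halves]
  · intro α hα
    obtain ⟨i, hi⟩ := Set.mem_iUnion.mp (hcov hα)
    refine ⟨i, ?_⟩
    have hne : (t i).Nonempty := ⟨α, hi⟩
    have hy : y i ∈ t i := by
      simp only [y, dif_pos hne]; exact hne.some_mem
    have h1 : edist α (y i) ≤ Metric.ediam (t i) := Metric.edist_le_ediam_of_mem hi hy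
    have h2 : dist α (y i) ≤ D i := by
      rw [dist_edist]
      exact ENNReal.toReal_mono (hDtop i) h1
    have h3 : D i ≤ r i := by
      rw [← Real.rpow_le_rpow_iff (hD0 i) (hr0 i).le hs0, hrs]
      linarith [hδR i]
    rw [Metric.mem_closedBall]
    exact h2.trans h3

theorem stmt_10 (p : ℕ) (hp : p.Prime) :
    dimH {α : ℝ |
      0 < atTop.liminf (fun q : ℕ =>
        (q : ℝ) * (Real.log q) ^ 2 * nint (q * α) * pabs p q)} = 1 := by
  apply le_antisymm
  · refine (dimH_mono (Set.subset_univ _)).trans ?_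
    rw [Real.dimH_univ]
  · by_contra hcon
    push Not at hcon
    obtain ⟨s, hs1, hs2⟩ := ENNReal.lt_iff_exists_nnreal_btwn.mp hcon
    have hs0 : (0 : ℝ) < s := by
      have : (0 : ENNReal) < s := lt_of_le_of_lt zero_le hs1
      exact_mod_cast this
    have hs1' : (s : ℝ) < 1 := by exact_mod_cast hs2
    have hμ := hausdorffMeasure_of_dimH_lt hs1
    obtain ⟨K0, hK0, hl1, hl2, hl3, hl4⟩ := exists_K0 hp hs1'
    have hl := ell_pos hp K0
    have hk := kap_pos hp
    obtain ⟨y, r, hr, hsum, hcov⟩ := exists_cover hs0 hμ (ε := kap p * ell p K0 ^ (s : ℝ)) (by positivity)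
    obtain ⟨α, hα1, hα2, hα3⟩ := construct hp hK0 hl1 y r hr hs0 hs1' hl3 hl4 hsum
    obtain ⟨i, hi⟩ := hcov α (liminf_pos hp hK0 hl2 hα2 hα3)
    exact hα1 i hi
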